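/- arXiv:1304.5829 — 2 statements merged into one kernel-verified Lean document; each statement's English description precedes it below -/
import Mathlib

section
/- Let M be a positive definite ternary ℤ-lattice with |O(M)| = 8 and squarefree discriminant. Then M is isometric to a diagonal lattice ⟨a,b,c⟩ = diag(a,b,c) or to the lattice ⟨a⟩ ⊥ [[ (b+c)/2, (b−c)/2 ],[ (b−c)/2, (b+c)/2 ]] for suitable positive integers a, b, c (with b ≡ c mod 2 in the second case). -/
open Matrix

/-- A nonzero integer vector is a multiple of a primitive one. -/
lemma exists_primitive_factor (c : Fin 3 → ℤ) (hc : c ≠ 0) :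
    ∃ (g : ℤ) (z u : Fin 3 → ℤ), g ≠ 0 ∧ c = g • z ∧ u ⬝ᵥ z = 1 := by
  obtain ⟨g, hg⟩ := (IsPrincipalIdealRing.principal (Ideal.span (Set.range c))).principal
  have hdvd : ∀ i, g ∣ c i := fun i => by
    have : c i ∈ Ideal.span (Set.range c) := Ideal.subset_span ⟨i, rfl⟩
    rw [hg] at this
    exact Ideal.mem_span_singleton.1 this
  have hmem : g ∈ Ideal.span (Set.range c) := by
    rw [hg]; exact Ideal.mem_span_singleton_self g
  obtain ⟨u, hu⟩ := Ideal.mem_span_range_iff_exists_fun.1 hmem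
  choose z hz using hdvd
  have hg0 : g ≠ 0 := by
    rintro rfl
    exact hc (funext fun i => by simp [hz i])
  refine ⟨g, z, u, hg0, funext fun i => by simp [hz i], mul_left_cancel₀ hg0 ?_⟩
  rw [mul_one, dotProduct, Finset.mul_sum]
  conv_rhs => rw [← hu]
  exact Finset.sum_congr rfl fun i _ => by rw [hz i]; ring

/-- An integral matrix of rank one whose trace is nonzero factors through a primitive vector. -/
lemma exists_eq_vecMulVec (X : Matrix (Fin 3) (Fin 3) ℤ) (ht : X.trace ≠ 0)
    (hX : ∀ i j k l, X i j * X k l = X i l * X k j) :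
    ∃ z w u : Fin 3 → ℤ, u ⬝ᵥ z = 1 ∧ X = vecMulVec z w ∧ w ⬝ᵥ z = X.trace := by
  obtain ⟨j, hj⟩ : ∃ j, (fun i => X i j) ≠ 0 := by
    by_contra! h
    exact ht (Finset.sum_eq_zero fun i _ => congrFun (h i) i)
  obtain ⟨g, z, u, hg, hc, hu⟩ := exists_primitive_factor _ hj
  have hcol : ∀ k l i, X i l * z k = z i * X k l := fun k l i => by
    have h := hX i l k j
    have h1 : X k j = g * z k := congrFun hc k
    have h2 : X i j = g * z i := congrFun hc i
    rw [h1, h2] at h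
    exact mul_left_cancel₀ hg (by linear_combination h)
  have hfac : X = vecMulVec z (fun l => ∑ k, u k * X k l) := by
    ext i l
    rw [vecMulVec_apply, Finset.mul_sum]
    calc X i l = X i l * (u ⬝ᵥ z) := by rw [hu, mul_one]
      _ = ∑ k, z i * (u k * X k l) := by
        rw [dotProduct, Finset.mul_sum]
        exact Finset.sum_congr rfl fun k _ => by linear_combination u k * hcol k l i
  refine ⟨z, _, u, hu, hfac, ?_⟩
  conv_rhs => rw [hfac, trace_vecMulVec]
  rw [dotProduct_comm]

/-- An integral rotation of order two is a half-turn about a primitive vector. -/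
lemma exists_axis_of_involution (A : Matrix (Fin 3) (Fin 3) ℤ) (hdet : A.det = 1)
    (hA : A * A = 1) (h1 : A ≠ 1) :
    ∃ z w u : Fin 3 → ℤ, u ⬝ᵥ z = 1 ∧ 1 + A = vecMulVec z w ∧ w ⬝ᵥ z = 2 := by
  have hadj : A.adjugate = A := by
    have h := mul_adjugate A
    rw [hdet, one_smul] at h
    calc A.adjugate = A * A * A.adjugate := by rw [hA, one_mul]
      _ = A := by rw [mul_assoc, h, mul_one]
  have hsq : ∀ i j, A i 0 * A 0 j + A i 1 * A 1 j + A i 2 * A 2 j = (1 : Matrix _ _ ℤ) i j :=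
    fun i j => by rw [← hA, mul_apply, Fin.sum_univ_three]
  have had : ∀ i j, A.adjugate i j = A i j := fun i j => by rw [hadj]
  rw [adjugate_fin_three] at had
  have a00 := had 0 0
  have a01 := had 0 1
  have a02 := had 0 2
  have a10 := had 1 0
  have a11 := had 1 1
  have a12 := had 1 2
  have a20 := had 2 0
  have a21 := had 2 1
  have a22 := had 2 2
  have s00 := hsq 0 0
  have s01 := hsq 0 1
  have s02 := hsq 0 2
  have s10 := hsq 1 0
  have s11 := hsq 1 1
  have s12 := hsq 1 2
  have s20 := hsq 2 0
  have s21 := hsq 2 1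
  have s22 := hsq 2 2
  simp at a00 a01 a02 a10 a11 a12 a20 a21 a22 s00 s01 s02 s10 s11 s12 s20 s21 s22
  have htr : 1 + (A 0 0 + A 1 1 + A 2 2) = 0 := by
    by_contra ht
    apply h1
    ext i j
    apply mul_left_cancel₀ ht
    fin_cases i <;> fin_cases j <;> simp
    · linear_combination s00 + a11 + a22
    · rw [← mul_eq_zero]; linear_combination s01 - a01
    · rw [← mul_eq_zero]; linear_combination s02 - a02
    · rw [← mul_eq_zero]; linear_combination s10 - a10
    · linear_combination s11 + a00 + a22
    · rw [← mul_eq_zero]; linear_combination s12 - a12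
    · rw [← mul_eq_zero]; linear_combination s20 - a20
    · rw [← mul_eq_zero]; linear_combination s21 - a21
    · linear_combination s22 + a00 + a11
  have htr2 : (1 + A).trace = 2 := by
    simp [trace, Fin.sum_univ_three]
    linear_combination htr
  obtain ⟨z, w, u, hu, hX, hw⟩ := exists_eq_vecMulVec (1 + A) (by rw [htr2]; norm_num) (by
    intro i j k l
    fin_cases i <;> fin_cases j <;> fin_cases k <;> fin_cases l <;> simp <;>
    first
    | ring1
    | linear_combination a00 + htr
    | linear_combination a11 + htr
    | linear_combination a22 + htr
    | linear_combination -a00 - htr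
    | linear_combination -a11 - htr
    | linear_combination -a22 - htr
    | linear_combination a01
    | linear_combination -a01
    | linear_combination a02
    | linear_combination -a02
    | linear_combination a10
    | linear_combination -a10
    | linear_combination a12
    | linear_combination -a12
    | linear_combination a20
    | linear_combination -a20
    | linear_combination a21
    | linear_combination -a21)
  exact ⟨z, w, u, hu, hX, hw.trans htr2⟩

/-- Three vectors spanning `ℤ³` form a unimodular matrix. -/
lemma isUnit_det_of_forall_exists (u : Fin 3 → Fin 3 → ℤ)
    (h : ∀ x, ∃ p q r : ℤ, x = p • u 0 + q • u 1 + r • u 2) :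
    IsUnit ((of u)ᵀ).det := by
  choose p q r h using h
  rw [det_transpose]
  apply isUnit_det_of_left_inverse
    (B := of fun i => ![p (Pi.single i 1), q (Pi.single i 1), r (Pi.single i 1)])
  ext i j
  have := congrFun (h (Pi.single i 1)) j
  simp [mul_apply, Fin.sum_univ_three, Matrix.one_apply, Pi.single_apply] at this ⊢
  rw [← this]
  simp [eq_comm]

lemma transpose_mul_mul_apply (G : Matrix (Fin 3) (Fin 3) ℤ) (u : Fin 3 → Fin 3 → ℤ)
    (i j : Fin 3) : ((of u)ᵀᵀ * G * (of u)ᵀ) i j = Matrix.toBilin' G (u i) (u j) := by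
  rw [Matrix.toBilin'_apply', transpose_transpose, mul_assoc, mul_apply]
  rfl

lemma toBilin'_comm {G : Matrix (Fin 3) (Fin 3) ℤ} (hG : G.IsSymm) (x y : Fin 3 → ℤ) :
    Matrix.toBilin' G x y = Matrix.toBilin' G y x := by
  rw [Matrix.toBilin'_apply', Matrix.toBilin'_apply', dotProduct_mulVec, dotProduct_comm,
    ← mulVec_transpose, hG]

lemma toBilin'_mulVec {G A : Matrix (Fin 3) (Fin 3) ℤ} (hA : Aᵀ * G * A = G)
    (x y : Fin 3 → ℤ) :
    Matrix.toBilin' G (A *ᵥ x) (A *ᵥ y) = Matrix.toBilin' G x y := by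
  rw [Matrix.toBilin'_apply', Matrix.toBilin'_apply']
  conv_rhs => rw [← hA]
  rw [← mulVec_mulVec, ← mulVec_mulVec, dotProduct_mulVec x, vecMul_transpose]

/-- An orthogonal frame of primitive vectors whose span contains `2ℤ³`. -/
structure IsOrthogonalFrame (G : Matrix (Fin 3) (Fin 3) ℤ) (z : Fin 3 → Fin 3 → ℤ) : Prop where
  symm : G.IsSymm
  pos : ∀ i, 0 < Matrix.toBilin' G (z i) (z i)
  orth : ∀ i j, i ≠ j → Matrix.toBilin' G (z i) (z j) = 0
  exists_two_smul : ∀ x : Fin 3 → ℤ, ∃ c : Fin 3 → ℤ, (2 : ℤ) • x = ∑ i, c i • z i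
  two_smul_ne : ∀ i (y : Fin 3 → ℤ), (2 : ℤ) • y ≠ z i

namespace IsOrthogonalFrame

variable {G : Matrix (Fin 3) (Fin 3) ℤ} {z : Fin 3 → Fin 3 → ℤ}

lemma perm (h : IsOrthogonalFrame G z) (σ : Equiv.Perm (Fin 3)) :
    IsOrthogonalFrame G (z ∘ σ) where
  symm := h.symm
  pos i := h.pos (σ i)
  orth i j hij := h.orth _ _ (σ.injective.ne hij)
  exists_two_smul x := by
    obtain ⟨c, hc⟩ := h.exists_two_smul x
    exact ⟨c ∘ σ, hc.trans (Equiv.sum_comp σ fun i => c i • z i).symm⟩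
  two_smul_ne i := h.two_smul_ne (σ i)

lemma exists_coeff (h : IsOrthogonalFrame G z) (x : Fin 3 → ℤ) :
    ∃ p q r : ℤ, ∀ k, 2 * x k = p * z 0 k + q * z 1 k + r * z 2 k := by
  obtain ⟨c, hc⟩ := h.exists_two_smul x
  exact ⟨c 0, c 1, c 2, fun k => by simpa [Fin.sum_univ_three] using congrFun hc k⟩

lemma false_of_eq (h : IsOrthogonalFrame G z) (i : Fin 3) (y : Fin 3 → ℤ)
    (hy : ∀ k, 2 * y k = z i k) : False :=
  h.two_smul_ne i y (funext fun k => by simpa using hy k)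

lemma isUnit_det_of_coeff (u : Fin 3 → Fin 3 → ℤ)
    (h : ∀ x : Fin 3 → ℤ, ∃ p q r : ℤ, ∀ k, 2 * x k = 2 * (p * u 0 k + q * u 1 k + r * u 2 k)) :
    IsUnit ((of u)ᵀ).det :=
  isUnit_det_of_forall_exists u fun x => by
    obtain ⟨p, q, r, hx⟩ := h x
    exact ⟨p, q, r, funext fun k => by
      simpa using mul_left_cancel₀ two_ne_zero (hx k)⟩

lemma det_eq_of_isUnit (u : Fin 3 → Fin 3 → ℤ) (hu : IsUnit ((of u)ᵀ).det) :
    G.det = (of fun i j => Matrix.toBilin' G (u i) (u j)).det := by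
  have h : (of fun i j => Matrix.toBilin' G (u i) (u j)) = (of u)ᵀᵀ * G * (of u)ᵀ := by
    ext i j
    rw [transpose_mul_mul_apply]; rfl
  rw [h, det_mul, det_mul, det_transpose ((of u)ᵀ)]
  rcases Int.isUnit_iff.1 hu with hu | hu <;> rw [hu] <;> ring

lemma false_of_four_dvd (hsf : Squarefree G.det) {m : ℤ} (hm : G.det = 4 * m) : False := by
  have := hsf 2 ⟨m, by rw [hm]; ring⟩
  rw [Int.isUnit_iff] at this
  omega

/-- The body-centred case. -/
lemma body_centred (h : IsOrthogonalFrame G z) (hsf : Squarefree G.det) (u : Fin 3 → ℤ)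
    (hu : ∀ k, 2 * u k = z 0 k + z 1 k + z 2 k) : False := by
  have hunit : IsUnit ((of ![z 0, z 1, u])ᵀ).det := by
    refine isUnit_det_of_coeff _ fun x => ?_
    obtain ⟨p, q, r, hx⟩ := h.exists_coeff x
    simp only [Matrix.cons_val]
    rcases Int.even_or_odd' p with ⟨p', hp | hp⟩ <;>
    rcases Int.even_or_odd' q with ⟨q', hq | hq⟩ <;>
    rcases Int.even_or_odd' r with ⟨r', hr | hr⟩ <;> subst hp hq hr
    · exact ⟨p' - r', q' - r', 2 * r', fun k => by
        linear_combination hx k - 2 * r' * hu k⟩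
    · refine (h.false_of_eq 2 (x - p' • z 0 - q' • z 1 - r' • z 2) fun k => ?_).elim
      simp; linear_combination hx k
    · refine (h.false_of_eq 1 (x - p' • z 0 - q' • z 1 - r' • z 2) fun k => ?_).elim
      simp; linear_combination hx k
    · refine (h.false_of_eq 0 (u - x + p' • z 0 + q' • z 1 + r' • z 2) fun k => ?_).elim
      simp; linear_combination hu k - hx k
    · refine (h.false_of_eq 0 (x - p' • z 0 - q' • z 1 - r' • z 2) fun k => ?_).elim
      simp; linear_combination hx k
    · refine (h.false_of_eq 1 (u - x + p' • z 0 + q' • z 1 + r' • z 2) fun k => ?_).elim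
      simp; linear_combination hu k - hx k
    · refine (h.false_of_eq 2 (u - x + p' • z 0 + q' • z 1 + r' • z 2) fun k => ?_).elim
      simp; linear_combination hu k - hx k
    · exact ⟨p' - r', q' - r', 2 * r' + 1, fun k => by
        linear_combination hx k - (2 * r' + 1) * hu k⟩
  have hu' : (2 : ℤ) • u = z 0 + z 1 + z 2 := funext fun k => by simpa using hu k
  have key : ∀ y, 2 * Matrix.toBilin' G u y =
      Matrix.toBilin' G (z 0) y + Matrix.toBilin' G (z 1) y + Matrix.toBilin' G (z 2) y :=
    fun y => by
      have := congrArg (fun v => Matrix.toBilin' G v y) hu'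
      simpa only [map_add, map_smul, LinearMap.add_apply, LinearMap.smul_apply, smul_eq_mul]
        using this
  have k0 := key (z 0)
  have k1 := key (z 1)
  have k2 := key (z 2)
  have ku := key u
  have hdet := det_eq_of_isUnit (G := G) _ hunit
  rw [det_fin_three (of _)] at hdet
  simp only [of_apply, Matrix.cons_val] at hdet
  rw [h.orth 1 0 (by decide), h.orth 2 0 (by decide)] at k0
  rw [h.orth 0 1 (by decide), h.orth 2 1 (by decide)] at k1
  rw [h.orth 0 2 (by decide), h.orth 1 2 (by decide)] at k2
  rw [toBilin'_comm h.symm (z 0) u, toBilin'_comm h.symm (z 1) u,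
    toBilin'_comm h.symm (z 2) u] at ku
  rw [h.orth 0 1 (by decide), h.orth 1 0 (by decide), toBilin'_comm h.symm (z 0) u,
    toBilin'_comm h.symm (z 1) u] at hdet
  generalize Matrix.toBilin' G u (z 0) = a at *
  generalize Matrix.toBilin' G u (z 1) = b at *
  generalize Matrix.toBilin' G u (z 2) = c at *
  generalize Matrix.toBilin' G u u = n at *
  have ha : Matrix.toBilin' G (z 0) (z 0) = 2 * a := by linarith
  have hb : Matrix.toBilin' G (z 1) (z 1) = 2 * b := by linarith
  rw [ha, hb] at hdet
  have hd : G.det = 2 * (a * b * c) := by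
    rw [hdet]; linear_combination 2 * a * b * ku
  have heven : Even (a * b * c) := by
    have : Even (a + b + c) := ⟨n, by linarith⟩
    simp only [Int.even_add, Int.even_mul] at this ⊢
    tauto
  obtain ⟨m, hm⟩ := heven
  exact false_of_four_dvd hsf (m := m) (by rw [hd, hm]; ring)

/-- The face-centred case. -/
lemma face_centred (h : IsOrthogonalFrame G z) (hsf : Squarefree G.det) (u v : Fin 3 → ℤ)
    (hu : ∀ k, 2 * u k = z 0 k + z 1 k) (hv : ∀ k, 2 * v k = z 0 k + z 2 k) : False := by
  have hunit : IsUnit ((of ![z 0, u, v])ᵀ).det := by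
    refine isUnit_det_of_coeff _ fun x => ?_
    obtain ⟨p, q, r, hx⟩ := h.exists_coeff x
    simp only [Matrix.cons_val]
    rcases Int.even_or_odd' (p - q - r) with ⟨m, hm | hm⟩
    · exact ⟨m, q, r, fun k => by
        linear_combination hx k - q * hu k - r * hv k + z 0 k * hm⟩
    · refine (h.false_of_eq 0 (x - m • z 0 - q • u - r • v) fun k => ?_).elim
      simp; linear_combination hx k - q * hu k - r * hv k + z 0 k * hm
  have hu' : (2 : ℤ) • u = z 0 + z 1 := funext fun k => by simpa using hu k
  have hv' : (2 : ℤ) • v = z 0 + z 2 := funext fun k => by simpa using hv k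
  have keyu : ∀ y, 2 * Matrix.toBilin' G u y =
      Matrix.toBilin' G (z 0) y + Matrix.toBilin' G (z 1) y := fun y => by
    have := congrArg (fun v => Matrix.toBilin' G v y) hu'
    simpa only [map_add, map_smul, LinearMap.add_apply, LinearMap.smul_apply, smul_eq_mul]
      using this
  have keyv : ∀ y, 2 * Matrix.toBilin' G v y =
      Matrix.toBilin' G (z 0) y + Matrix.toBilin' G (z 2) y := fun y => by
    have := congrArg (fun v => Matrix.toBilin' G v y) hv'
    simpa only [map_add, map_smul, LinearMap.add_apply, LinearMap.smul_apply, smul_eq_mul]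
      using this
  have u0 := keyu (z 0)
  have u1 := keyu (z 1)
  have u2 := keyu (z 2)
  have uu := keyu u
  have vu := keyv u
  have vv := keyv v
  have v0 := keyv (z 0)
  have v2 := keyv (z 2)
  have hdet := det_eq_of_isUnit (G := G) _ hunit
  rw [det_fin_three (of _)] at hdet
  simp only [of_apply, Matrix.cons_val] at hdet
  rw [h.orth 1 0 (by decide)] at u0
  rw [h.orth 0 1 (by decide)] at u1
  rw [h.orth 0 2 (by decide), h.orth 1 2 (by decide)] at u2
  rw [h.orth 2 0 (by decide)] at v0
  rw [h.orth 0 2 (by decide)] at v2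
  rw [toBilin'_comm h.symm (z 0) u, toBilin'_comm h.symm (z 1) u] at uu
  rw [toBilin'_comm h.symm (z 0) u, toBilin'_comm h.symm (z 2) u] at vu
  rw [toBilin'_comm h.symm (z 0) v, toBilin'_comm h.symm (z 2) v] at vv
  rw [toBilin'_comm h.symm (z 0) u, toBilin'_comm h.symm (z 0) v,
    toBilin'_comm h.symm u v] at hdet
  generalize Matrix.toBilin' G u (z 0) = a at *
  generalize Matrix.toBilin' G v (z 0) = a' at *
  generalize Matrix.toBilin' G u (z 1) = b at *
  generalize Matrix.toBilin' G u (z 2) = d at *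
  generalize Matrix.toBilin' G v (z 2) = c at *
  generalize Matrix.toBilin' G v u = e at *
  have ha' : a' = 2 * e := by linarith
  have ha : a = 2 * e := by linarith
  have h0 : Matrix.toBilin' G (z 0) (z 0) = 4 * e := by linarith
  have hb : b = 2 * (Matrix.toBilin' G u u - e) := by linarith
  have hc : c = 2 * (Matrix.toBilin' G v v - e) := by linarith
  refine false_of_four_dvd hsf
    (m := e * (Matrix.toBilin' G u u - e) * (Matrix.toBilin' G v v - e)) ?_
  rw [hdet, ha, ha', h0]; ring

lemma base_centred (h : IsOrthogonalFrame G z) (u : Fin 3 → ℤ)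
    (hu : ∀ k, 2 * u k = z 0 k + z 1 k)
    (h02 : ¬ ∃ v : Fin 3 → ℤ, ∀ k, 2 * v k = z 0 k + z 2 k)
    (h12 : ¬ ∃ v : Fin 3 → ℤ, ∀ k, 2 * v k = z 1 k + z 2 k) :
    ∃ a b c : ℤ, 0 < a ∧ 0 < b ∧ 0 < c ∧ ∃ s t : ℤ, s + t = b ∧ s - t = c ∧
      ∃ U : Matrix (Fin 3) (Fin 3) ℤ, IsUnit U.det ∧
        Uᵀ * G * U = !![a,0,0; 0,s,t; 0,t,s] := by
  have hunit : IsUnit ((of ![z 2, u, u - z 1])ᵀ).det := by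
    refine isUnit_det_of_coeff _ fun x => ?_
    obtain ⟨p, q, r, hx⟩ := h.exists_coeff x
    simp only [Matrix.cons_val, Pi.sub_apply]
    rcases Int.even_or_odd' p with ⟨p', hp | hp⟩ <;>
    rcases Int.even_or_odd' q with ⟨q', hq | hq⟩ <;>
    rcases Int.even_or_odd' r with ⟨r', hr | hr⟩ <;> subst hp hq hr
    · exact ⟨r', p' + q', p' - q', fun k => by
        linear_combination hx k - 2 * p' * hu k⟩
    · refine (h.false_of_eq 2 (x - p' • z 0 - q' • z 1 - r' • z 2) fun k => ?_).elim
      simp; linear_combination hx k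
    · refine (h.false_of_eq 1 (x - p' • z 0 - q' • z 1 - r' • z 2) fun k => ?_).elim
      simp; linear_combination hx k
    · refine (h12 ⟨x - p' • z 0 - q' • z 1 - r' • z 2, fun k => ?_⟩).elim
      simp; linear_combination hx k
    · refine (h.false_of_eq 0 (x - p' • z 0 - q' • z 1 - r' • z 2) fun k => ?_).elim
      simp; linear_combination hx k
    · refine (h02 ⟨x - p' • z 0 - q' • z 1 - r' • z 2, fun k => ?_⟩).elim
      simp; linear_combination hx k
    · exact ⟨r', p' + q' + 1, p' - q', fun k => by
        linear_combination hx k - (2 * p' + 1) * hu k⟩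
    · refine (h.false_of_eq 2 (x - u - p' • z 0 - q' • z 1 - r' • z 2) fun k => ?_).elim
      simp; linear_combination hx k - hu k
  have hu' : (2 : ℤ) • u = z 0 + z 1 := funext fun k => by simpa using hu k
  have key : ∀ y, 2 * Matrix.toBilin' G u y =
      Matrix.toBilin' G (z 0) y + Matrix.toBilin' G (z 1) y := fun y => by
    have := congrArg (fun v => Matrix.toBilin' G v y) hu'
    simpa only [map_add, map_smul, LinearMap.add_apply, LinearMap.smul_apply, smul_eq_mul]
      using this
  have k0 := key (z 0)
  have k1 := key (z 1)
  have k2 := key (z 2)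
  have ku := key u
  have p0 := h.pos 0
  have p1 := h.pos 1
  rw [h.orth 1 0 (by decide)] at k0
  rw [h.orth 0 1 (by decide)] at k1
  rw [h.orth 0 2 (by decide), h.orth 1 2 (by decide)] at k2
  rw [toBilin'_comm h.symm (z 0) u, toBilin'_comm h.symm (z 1) u] at ku
  refine ⟨_, _, _, h.pos 2, ?_, ?_, Matrix.toBilin' G u u,
    Matrix.toBilin' G u u - Matrix.toBilin' G u (z 1), rfl, rfl, _, hunit, ?_⟩
  · linarith
  · linarith
  ext i j
  rw [transpose_mul_mul_apply]
  have c2 := toBilin'_comm h.symm (z 2) u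
  have c1 := toBilin'_comm h.symm (z 1) u
  have o12 := h.orth 1 2 (by decide)
  have o21 := h.orth 2 1 (by decide)
  fin_cases i <;> fin_cases j <;>
    simp [map_sub, LinearMap.sub_apply] <;> linarith

lemma diagonal (h : IsOrthogonalFrame G z)
    (h01 : ¬ ∃ v : Fin 3 → ℤ, ∀ k, 2 * v k = z 0 k + z 1 k)
    (h02 : ¬ ∃ v : Fin 3 → ℤ, ∀ k, 2 * v k = z 0 k + z 2 k)
    (h12 : ¬ ∃ v : Fin 3 → ℤ, ∀ k, 2 * v k = z 1 k + z 2 k)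
    (h012 : ¬ ∃ v : Fin 3 → ℤ, ∀ k, 2 * v k = z 0 k + z 1 k + z 2 k) :
    ∃ a b c : ℤ, 0 < a ∧ 0 < b ∧ 0 < c ∧
      ∃ U : Matrix (Fin 3) (Fin 3) ℤ, IsUnit U.det ∧
        Uᵀ * G * U = !![a,0,0; 0,b,0; 0,0,c] := by
  have hunit : IsUnit ((of z)ᵀ).det := by
    refine isUnit_det_of_coeff _ fun x => ?_
    obtain ⟨p, q, r, hx⟩ := h.exists_coeff x
    rcases Int.even_or_odd' p with ⟨p', hp | hp⟩ <;>
    rcases Int.even_or_odd' q with ⟨q', hq | hq⟩ <;>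
    rcases Int.even_or_odd' r with ⟨r', hr | hr⟩ <;> subst hp hq hr
    · exact ⟨p', q', r', fun k => by linear_combination hx k⟩
    · refine (h.false_of_eq 2 (x - p' • z 0 - q' • z 1 - r' • z 2) fun k => ?_).elim
      simp; linear_combination hx k
    · refine (h.false_of_eq 1 (x - p' • z 0 - q' • z 1 - r' • z 2) fun k => ?_).elim
      simp; linear_combination hx k
    · refine (h12 ⟨x - p' • z 0 - q' • z 1 - r' • z 2, fun k => ?_⟩).elim
      simp; linear_combination hx k
    · refine (h.false_of_eq 0 (x - p' • z 0 - q' • z 1 - r' • z 2) fun k => ?_).elim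
      simp; linear_combination hx k
    · refine (h02 ⟨x - p' • z 0 - q' • z 1 - r' • z 2, fun k => ?_⟩).elim
      simp; linear_combination hx k
    · refine (h01 ⟨x - p' • z 0 - q' • z 1 - r' • z 2, fun k => ?_⟩).elim
      simp; linear_combination hx k
    · refine (h012 ⟨x - p' • z 0 - q' • z 1 - r' • z 2, fun k => ?_⟩).elim
      simp; linear_combination hx k
  refine ⟨_, _, _, h.pos 0, h.pos 1, h.pos 2, _, hunit, ?_⟩
  ext i j
  rw [transpose_mul_mul_apply]
  fin_cases i <;> fin_cases j <;> first | rfl | exact h.orth _ _ (by decide)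

lemma classification (h : IsOrthogonalFrame G z) (hsf : Squarefree G.det) :
    ∃ a b c : ℤ, 0 < a ∧ 0 < b ∧ 0 < c ∧
      ((∃ U : Matrix (Fin 3) (Fin 3) ℤ, IsUnit U.det ∧
          Uᵀ * G * U = !![a,0,0; 0,b,0; 0,0,c]) ∨
       (∃ s t : ℤ, s + t = b ∧ s - t = c ∧
          ∃ U : Matrix (Fin 3) (Fin 3) ℤ, IsUnit U.det ∧
            Uᵀ * G * U = !![a,0,0; 0,s,t; 0,t,s])) := by
  by_cases h012 : ∃ v : Fin 3 → ℤ, ∀ k, 2 * v k = z 0 k + z 1 k + z 2 k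
  · obtain ⟨u, hu⟩ := h012
    exact (h.body_centred hsf u hu).elim
  by_cases h01 : ∃ v : Fin 3 → ℤ, ∀ k, 2 * v k = z 0 k + z 1 k
  · obtain ⟨u, hu⟩ := h01
    obtain ⟨a, b, c, ha, hb, hc, hU⟩ := h.base_centred u hu
      (fun ⟨v, hv⟩ => h.face_centred hsf u v hu hv)
      (fun ⟨v, hv⟩ => (h.perm (Equiv.swap 0 1)).face_centred hsf u v
        (fun k => (hu k).trans (add_comm _ _)) hv)
    exact ⟨a, b, c, ha, hb, hc, Or.inr hU⟩
  by_cases h02 : ∃ v : Fin 3 → ℤ, ∀ k, 2 * v k = z 0 k + z 2 k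
  · obtain ⟨u, hu⟩ := h02
    obtain ⟨a, b, c, ha, hb, hc, hU⟩ := (h.perm (Equiv.swap 1 2)).base_centred u hu h01
      (fun ⟨v, hv⟩ => (h.perm (Equiv.swap 0 2)).face_centred hsf v u
        (fun k => hv k) (fun k => (hu k).trans (add_comm _ _)))
    exact ⟨a, b, c, ha, hb, hc, Or.inr hU⟩
  by_cases h12 : ∃ v : Fin 3 → ℤ, ∀ k, 2 * v k = z 1 k + z 2 k
  · obtain ⟨u, hu⟩ := h12
    obtain ⟨a, b, c, ha, hb, hc, hU⟩ := (h.perm (Equiv.swap 0 2)).base_centred u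
      (fun k => (hu k).trans (add_comm _ _))
      (fun ⟨v, hv⟩ => h02 ⟨v, fun k => (hv k).trans (add_comm _ _)⟩)
      (fun ⟨v, hv⟩ => h01 ⟨v, fun k => (hv k).trans (add_comm _ _)⟩)
    exact ⟨a, b, c, ha, hb, hc, Or.inr hU⟩
  obtain ⟨a, b, c, ha, hb, hc, hU⟩ := h.diagonal h01 h02 h12 h012
  exact ⟨a, b, c, ha, hb, hc, Or.inl hU⟩

end IsOrthogonalFrame

lemma exists_nearest_multiple (a : ℤ) {q : ℤ} (hq : 0 < q) :
    ∃ m : ℤ, -q ≤ 2 * (a - m * q) ∧ 2 * (a - m * q) ≤ q := by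
  refine ⟨(2 * a + q) / (2 * q), ?_⟩
  have h1 := Int.mul_ediv_add_emod (2 * a + q) (2 * q)
  have h2 := Int.emod_nonneg (2 * a + q) (b := 2 * q) (by positivity)
  have h3 := Int.emod_lt_of_pos (2 * a + q) (b := 2 * q) (by positivity)
  constructor <;> linarith

lemma det_isometry_isUnit {G T : Matrix (Fin 3) (Fin 3) ℤ} (hG : G.det ≠ 0)
    (hT : Tᵀ * G * T = G) : IsUnit T.det := by
  have h := congrArg det hT
  rw [det_mul, det_mul, det_transpose] at h
  exact IsUnit.of_mul_eq_one _ (mul_right_cancel₀ hG (by linear_combination h))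

lemma eq_zero_of_mul_vecMulVec_eq_zero {X : Matrix (Fin 3) (Fin 3) ℤ} {z w : Fin 3 → ℤ}
    (hw : w ⬝ᵥ z = 2) (h : X * vecMulVec z w = 0) : X *ᵥ z = 0 := by
  have h1 := congrArg (fun M : Matrix (Fin 3) (Fin 3) ℤ => M *ᵥ z) h
  rw [mul_vecMulVec] at h1
  ext i
  have h2 := congrFun h1 i
  simp only [vecMulVec_mulVec, hw, zero_mulVec] at h2
  simpa using h2

section PosDef

variable {G : Matrix (Fin 3) (Fin 3) ℤ}

/-- A lattice with an isometry of order four has an isometry not commuting with it, namely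
the reflection in a shortest vector of the plane of rotation. -/
lemma exists_isometry_not_commute (hsymm : G.IsSymm)
    (hpd : ∀ x : Fin 3 → ℤ, x ≠ 0 → 0 < Matrix.toBilin' G x x)
    {A : Matrix (Fin 3) (Fin 3) ℤ} (hA : Aᵀ * G * A = G) (hA1 : A ≠ 1)
    (hA4 : (1 + A * A) * (1 - A) = 0) {z : Fin 3 → ℤ} (hz : z ≠ 0) (hAz : A *ᵥ z = z) :
    ∃ T : Matrix (Fin 3) (Fin 3) ℤ, IsUnit T.det ∧ Tᵀ * G * T = G ∧ A * T ≠ T * A := by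
  have hN : ∀ x, A *ᵥ A *ᵥ (x - A *ᵥ x) = -(x - A *ᵥ x) := fun x => by
    have h := congrArg (fun M : Matrix (Fin 3) (Fin 3) ℤ => M *ᵥ x) hA4
    simp only [← mulVec_mulVec, add_mulVec, sub_mulVec, one_mulVec, zero_mulVec] at h
    exact eq_neg_of_add_eq_zero_right h
  obtain ⟨v, ⟨hv0, hv⟩, hmin⟩ := (measure fun v => (Matrix.toBilin' G v v).toNat).wf.has_min
    {v : Fin 3 → ℤ | v ≠ 0 ∧ A *ᵥ A *ᵥ v = -v} (by
      by_contra hempty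
      apply hA1
      apply Matrix.ext_of_mulVec_single
      intro i
      by_contra hne
      exact hempty ⟨Pi.single i 1 - A *ᵥ Pi.single i 1, by
        rw [one_mulVec] at hne
        exact sub_ne_zero.2 (Ne.symm hne), hN _⟩)
  have hB := toBilin'_mulVec hA
  have hc := toBilin'_comm hsymm
  set w := A *ᵥ v with hw
  set q := Matrix.toBilin' G v v with hq
  have hq0 : 0 < q := hpd v hv0
  have hww : Matrix.toBilin' G w w = q := hB v v
  have hvw : Matrix.toBilin' G v w = 0 := by
    have h := hB v w
    rw [hv, map_neg, ← hw, hc w v] at h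
    linarith
  have hwv : Matrix.toBilin' G w v = 0 := by rw [hc, hvw]
  have hzN : ∀ y, A *ᵥ A *ᵥ y = -y → Matrix.toBilin' G z y = 0 := fun y hy => by
    have h1 := hB z y
    have h2 := hB z (A *ᵥ y)
    rw [hAz] at h1 h2
    rw [hy, map_neg] at h2
    linarith
  have hzv := hzN v hv
  have hzw : Matrix.toBilin' G z w = 0 := hzN w (by rw [hv, mulVec_neg])
  have hdet : (of ![v, w, z]).det * G.det * (of ![v, w, z]).det ≠ 0 := by
    have h : (of fun i j => Matrix.toBilin' G (![v, w, z] i) (![v, w, z] j)) =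
        (of ![v, w, z])ᵀᵀ * G * (of ![v, w, z])ᵀ := by
      ext i j
      rw [transpose_mul_mul_apply]; rfl
    have h' := congrArg det h
    rw [det_mul, det_mul, det_transpose, det_transpose, det_fin_three (of _)] at h'
    simp only [of_apply, Matrix.cons_val, hvw, hwv, hzv, hzw, hww, hc v z, hc w z, ← hq] at h'
    rw [← h']
    have hzz := hpd z hz
    have : 0 < q * q * Matrix.toBilin' G z z := by positivity
    linarith
  have hG0 : G.det ≠ 0 := fun h => hdet (by rw [h]; ring)
  have hP0 : (of ![v, w, z]).det ≠ 0 := fun h => hdet (by rw [h]; ring)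
  have hplane : ∀ s, A *ᵥ A *ᵥ s = -s → Matrix.toBilin' G v s = 0 →
      Matrix.toBilin' G w s = 0 → s = 0 := fun s hs h1 h2 => by
    apply eq_zero_of_mulVec_eq_zero hG0
    apply eq_zero_of_mulVec_eq_zero hP0
    ext i
    have h3 := hzN s hs
    rw [Matrix.toBilin'_apply'] at h1 h2 h3
    fin_cases i
    · exact h1
    · exact h2
    · exact h3
  have hspan : ∀ y, A *ᵥ A *ᵥ y = -y → ∃ m n : ℤ, y = m • v + n • w := fun y hy => by
    obtain ⟨m, hm1, hm2⟩ := exists_nearest_multiple (Matrix.toBilin' G v y) hq0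
    obtain ⟨n, hn1, hn2⟩ := exists_nearest_multiple (Matrix.toBilin' G w y) hq0
    refine ⟨m, n, ?_⟩
    set r := y - (m • v + n • w) with hr
    have hrN : A *ᵥ A *ᵥ r = -r := by
      simp only [hr, mulVec_sub, mulVec_add, mulVec_smul, ← hw, hv, hy, mulVec_neg]
      module
    have hvr : Matrix.toBilin' G v r = Matrix.toBilin' G v y - m * q := by
      rw [hr]
      simp only [map_sub, map_add, map_smul, smul_eq_mul, hvw, ← hq]
      ring
    have hwr : Matrix.toBilin' G w r = Matrix.toBilin' G w y - n * q := by
      rw [hr]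
      simp only [map_sub, map_add, map_smul, smul_eq_mul, hwv, hww]
      ring
    rw [← hvr] at hm1 hm2
    rw [← hwr] at hn1 hn2
    set a := Matrix.toBilin' G v r with ha
    set b := Matrix.toBilin' G w r with hb
    have hqr : q • r - (a • v + b • w) = 0 := by
      apply hplane
      · simp only [mulVec_sub, mulVec_add, mulVec_smul, ← hw, hv, hrN, mulVec_neg]
        module
      · simp only [map_sub, map_add, map_smul, smul_eq_mul, hvw, ← hq, ← ha]
        ring
      · simp only [map_sub, map_add, map_smul, smul_eq_mul, hwv, hww, ← hb]
        ring
    have hnorm : q * Matrix.toBilin' G r r = a * a + b * b := by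
      have h := congrArg (Matrix.toBilin' G r) hqr
      simp only [map_sub, map_add, map_smul, map_zero, smul_eq_mul, hc r v, hc r w] at h
      linarith
    by_contra hne
    have hr0 : r ≠ 0 := sub_ne_zero.2 hne
    apply hmin r ⟨hr0, hrN⟩
    have hlt : Matrix.toBilin' G r r < q := by
      by_contra! hge
      nlinarith
    exact (Int.toNat_lt_toNat hq0).2 hlt
  have hdvd : ∀ x, q ∣ 2 * Matrix.toBilin' G x v := fun x => by
    obtain ⟨m, n, hmn⟩ := hspan _ (hN x)
    refine ⟨m - n, ?_⟩
    have h1 : x - A *ᵥ A *ᵥ x = (m - n) • v + (m + n) • w := by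
      have h2 := congrArg (fun t => A *ᵥ t) hmn
      simp only [mulVec_sub, mulVec_add, mulVec_smul, ← hw, hv] at h2
      calc x - A *ᵥ A *ᵥ x = (x - A *ᵥ x) + (A *ᵥ x - A *ᵥ A *ᵥ x) := by abel
        _ = _ := by rw [hmn, h2]; module
    have h3 := congrArg (fun t => Matrix.toBilin' G t v) h1
    simp only [map_sub, map_add, map_smul, LinearMap.sub_apply, LinearMap.add_apply,
      LinearMap.smul_apply, smul_eq_mul, hwv, ← hq] at h3
    have h4 := hB (A *ᵥ x) w
    rw [hv, map_neg, hB] at h4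
    linarith
  choose k hk using fun i : Fin 3 => hdvd (Pi.single i 1)
  have hkx : ∀ x, q * (k ⬝ᵥ x) = 2 * Matrix.toBilin' G x v := fun x => by
    have : ∀ i, Matrix.toBilin' G (Pi.single i 1) v = (G *ᵥ v) i := fun i => by
      rw [Matrix.toBilin'_apply', single_one_dotProduct]
    rw [Matrix.toBilin'_apply', dotProduct, dotProduct, Finset.mul_sum, Finset.mul_sum]
    refine Finset.sum_congr rfl fun i _ => ?_
    have h := hk i
    rw [this] at h
    linear_combination -x i * h
  have hT : ∀ x, (1 - vecMulVec v k) *ᵥ x = x - (k ⬝ᵥ x) • v := fun x => by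
    rw [sub_mulVec, one_mulVec, vecMulVec_mulVec]
    ext i
    simp [mul_comm]
  have hTG : (1 - vecMulVec v k)ᵀ * G * (1 - vecMulVec v k) = G := by
    apply (Matrix.toBilin' (R₁ := ℤ) (n := Fin 3)).injective
    refine LinearMap.ext₂ fun x y => ?_
    rw [Matrix.toBilin'_apply', ← mulVec_mulVec, ← mulVec_mulVec, dotProduct_mulVec x,
      vecMul_transpose, ← Matrix.toBilin'_apply', hT, hT]
    simp only [map_sub, map_smul, LinearMap.sub_apply, LinearMap.smul_apply, smul_eq_mul, ← hq]
    have hx := hkx x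
    have hy := hkx y
    rw [hc v y]
    apply mul_left_cancel₀ (two_ne_zero (α := ℤ))
    linear_combination (k ⬝ᵥ y) * hx + (k ⬝ᵥ x) * hy
  refine ⟨1 - vecMulVec v k, det_isometry_isUnit hG0 hTG, hTG, fun hcomm => ?_⟩
  have hkv : k ⬝ᵥ v = 2 := mul_left_cancel₀ hq0.ne' (by rw [hkx, ← hq]; ring)
  have hkw : k ⬝ᵥ w = 0 := mul_left_cancel₀ hq0.ne' (by rw [hkx, hwv]; ring)
  have h := congrArg (fun M : Matrix (Fin 3) (Fin 3) ℤ => M *ᵥ v) hcomm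
  simp only [← mulVec_mulVec] at h
  rw [← hw, hT, hT, hkv, hkw, mulVec_sub, mulVec_smul, ← hw] at h
  have h5 := congrArg (Matrix.toBilin' G w) h
  simp only [map_sub, map_smul, smul_eq_mul, hww, hwv] at h5
  linarith

lemma toBilin'_eq_zero_of_fixed_of_negated {A : Matrix (Fin 3) (Fin 3) ℤ}
    (hA : Aᵀ * G * A = G) {x y : Fin 3 → ℤ} (hx : A *ᵥ x = x) (hy : A *ᵥ y = -y) :
    Matrix.toBilin' G x y = 0 := by
  have h := toBilin'_mulVec hA x y
  rw [hx, hy, map_neg] at h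
  linarith

/-- Two distinct commuting half-turns yield an orthogonal frame. -/
lemma exists_isOrthogonalFrame (hsymm : G.IsSymm)
    (hpd : ∀ x : Fin 3 → ℤ, x ≠ 0 → 0 < Matrix.toBilin' G x x)
    {A B : Matrix (Fin 3) (Fin 3) ℤ} (hA : Aᵀ * G * A = G) (hB : Bᵀ * G * B = G)
    (hAd : A.det = 1) (hBd : B.det = 1) (hA2 : A * A = 1) (hB2 : B * B = 1)
    (hA1 : A ≠ 1) (hB1 : B ≠ 1) (hAB : A ≠ B) (hcomm : A * B = B * A) :
    ∃ z, IsOrthogonalFrame G z := by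
  have hC1 : A * B ≠ 1 := fun h => hAB (by
    calc A = A * (B * B) := by rw [hB2, mul_one]
      _ = B := by rw [← mul_assoc, h, one_mul])
  have hC2 : A * B * (A * B) = 1 := by
    calc A * B * (A * B) = A * (B * A) * B := by noncomm_ring
      _ = (A * A) * (B * B) := by rw [← hcomm]; noncomm_ring
      _ = 1 := by rw [hA2, hB2, one_mul]
  obtain ⟨z0, w0, u0, hu0, he0, hw0⟩ := exists_axis_of_involution A hAd hA2 hA1
  obtain ⟨z1, w1, u1, hu1, he1, hw1⟩ := exists_axis_of_involution B hBd hB2 hB1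
  obtain ⟨z2, w2, u2, hu2, he2, hw2⟩ := exists_axis_of_involution (A * B)
    (by rw [det_mul, hAd, hBd, one_mul]) hC2 hC1
  have hsum : 1 + A + B + A * B = 0 := by
    have t0 := congrArg trace he0
    have t1 := congrArg trace he1
    have t2 := congrArg trace he2
    rw [trace_vecMulVec, dotProduct_comm, trace_add, trace_one, Fintype.card_fin] at t0 t1 t2
    rw [hw0] at t0
    rw [hw1] at t1
    rw [hw2] at t2
    have e1 : 1 + A + B + A * B = (w0 ⬝ᵥ z1) • vecMulVec z0 w1 := by
      calc 1 + A + B + A * B = (1 + A) * (1 + B) := by noncomm_ring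
        _ = _ := by rw [he0, he1, vecMulVec_mul_vecMulVec, vecMulVec_smul]
    have e2 : 1 + A + B + A * B = (w1 ⬝ᵥ z0) • vecMulVec z1 w0 := by
      calc 1 + A + B + A * B = (1 + B) * (1 + A) := by rw [hcomm]; noncomm_ring
        _ = _ := by rw [he0, he1, vecMulVec_mul_vecMulVec, vecMulVec_smul]
    have e3 := congrArg trace e1
    rw [trace_smul, trace_vecMulVec, trace_add, trace_add, trace_add, trace_one,
      Fintype.card_fin, smul_eq_mul, dotProduct_comm z0 w1] at e3
    push_cast at t0 t1 t2 e3
    have e4 : (w0 ⬝ᵥ z1) * (w1 ⬝ᵥ z0) = 0 := by linarith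
    rcases mul_eq_zero.1 e4 with h | h
    · rw [e1, h, zero_smul]
    · rw [e2, h, zero_smul]
  have fix : ∀ {X : Matrix (Fin 3) (Fin 3) ℤ} {z w : Fin 3 → ℤ}, X * X = 1 →
      1 + X = vecMulVec z w → w ⬝ᵥ z = 2 → X *ᵥ z = z := fun {X z w} hX he hw => by
    have h := eq_zero_of_mul_vecMulVec_eq_zero (X := X - 1) hw (by
      rw [← he]
      calc (X - 1) * (1 + X) = X * X - 1 := by noncomm_ring
        _ = 0 := by rw [hX, sub_self])
    rw [sub_mulVec, one_mulVec] at h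
    exact sub_eq_zero.1 h
  have neg : ∀ {X Y : Matrix (Fin 3) (Fin 3) ℤ} {z w : Fin 3 → ℤ}, (1 + X) * (1 + Y) = 0 →
      1 + Y = vecMulVec z w → w ⬝ᵥ z = 2 → X *ᵥ z = -z := fun {X Y z w} hX he hw => by
    have h := eq_zero_of_mul_vecMulVec_eq_zero (X := 1 + X) hw (by rw [← he, hX])
    rw [add_mulVec, one_mulVec] at h
    exact eq_neg_of_add_eq_zero_right h
  have o01 : Matrix.toBilin' G z0 z1 = 0 :=
    toBilin'_eq_zero_of_fixed_of_negated hA (fix hA2 he0 hw0) (neg (by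
      rw [← hsum]; noncomm_ring) he1 hw1)
  have o02 : Matrix.toBilin' G z0 z2 = 0 :=
    toBilin'_eq_zero_of_fixed_of_negated hA (fix hA2 he0 hw0) (neg (by
      calc (1 + A) * (1 + A * B) = 1 + A + (A * A) * B + A * B := by noncomm_ring
        _ = 0 := by rw [hA2, one_mul, hsum]) he2 hw2)
  have o12 : Matrix.toBilin' G z1 z2 = 0 :=
    toBilin'_eq_zero_of_fixed_of_negated hB (fix hB2 he1 hw1) (neg (by
      rw [hcomm]
      calc (1 + B) * (1 + B * A) = 1 + (B * B) * A + B + B * A := by noncomm_ring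
        _ = 0 := by rw [hB2, one_mul, ← hcomm, hsum]) he2 hw2)
  have ne_zero : ∀ {u z : Fin 3 → ℤ}, u ⬝ᵥ z = 1 → z ≠ 0 := by
    rintro u _ h rfl
    simp at h
  have prim : ∀ {u z : Fin 3 → ℤ}, u ⬝ᵥ z = 1 → ∀ y, (2 : ℤ) • y ≠ z := by
    rintro u _ h y rfl
    rw [dotProduct_smul, smul_eq_mul] at h
    omega
  refine ⟨![z0, z1, z2], hsymm, ?_, ?_, fun x => ⟨![w0 ⬝ᵥ x, w1 ⬝ᵥ x, w2 ⬝ᵥ x], ?_⟩, ?_⟩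
  · intro i
    fin_cases i
    exacts [hpd _ (ne_zero hu0), hpd _ (ne_zero hu1), hpd _ (ne_zero hu2)]
  · have o10 := o01
    have o20 := o02
    have o21 := o12
    rw [toBilin'_comm hsymm] at o10 o20 o21
    intro i j hij
    fin_cases i <;> fin_cases j <;> first | exact absurd rfl hij | assumption
  · have h : vecMulVec z0 w0 + vecMulVec z1 w1 + vecMulVec z2 w2 = 1 + 1 := by
      rw [← he0, ← he1, ← he2]
      calc 1 + A + (1 + B) + (1 + A * B) = (1 + A + B + A * B) + (1 + 1) := by abel
        _ = 1 + 1 := by rw [hsum, zero_add]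
    have h2 := congrArg (fun M : Matrix (Fin 3) (Fin 3) ℤ => M *ᵥ x) h
    simp only [add_mulVec, one_mulVec, vecMulVec_mulVec] at h2
    rw [two_smul, ← h2, Fin.sum_univ_three]
    ext i
    simp [mul_comm]
  · intro i
    fin_cases i
    exacts [prim hu0, prim hu1, prim hu2]

end PosDef

/-- The isometry group of the lattice with Gram matrix `G`. -/
def isometryGroup (G : Matrix (Fin 3) (Fin 3) ℤ) : Subgroup (Matrix (Fin 3) (Fin 3) ℤ)ˣ where
  carrier := {U | (U : Matrix (Fin 3) (Fin 3) ℤ)ᵀ * G * U = G}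
  one_mem' := by simp
  mul_mem' {U V} hU hV := by
    have hU' : (U : Matrix (Fin 3) (Fin 3) ℤ)ᵀ * G * U = G := hU
    have hV' : (V : Matrix (Fin 3) (Fin 3) ℤ)ᵀ * G * V = G := hV
    calc ((U * V : (Matrix (Fin 3) (Fin 3) ℤ)ˣ) : Matrix (Fin 3) (Fin 3) ℤ)ᵀ * G * (U * V : _)
        = (V : Matrix (Fin 3) (Fin 3) ℤ)ᵀ * ((U : Matrix (Fin 3) (Fin 3) ℤ)ᵀ * G * U) * V := by
          rw [Units.val_mul, transpose_mul]; noncomm_ring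
      _ = G := by rw [hU', hV']
  inv_mem' {U} hU := by
    have hU' : (U : Matrix (Fin 3) (Fin 3) ℤ)ᵀ * G * U = G := hU
    have h1 : ((U⁻¹ : (Matrix (Fin 3) (Fin 3) ℤ)ˣ) : Matrix (Fin 3) (Fin 3) ℤ)ᵀ *
        (U : Matrix (Fin 3) (Fin 3) ℤ)ᵀ = 1 := by
      rw [← transpose_mul, Units.mul_inv, transpose_one]
    change ((U⁻¹ : (Matrix (Fin 3) (Fin 3) ℤ)ˣ) : Matrix (Fin 3) (Fin 3) ℤ)ᵀ * G * (U⁻¹ : _) = G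
    conv_lhs => rw [← hU']
    rw [mul_assoc, mul_assoc _ (U : Matrix (Fin 3) (Fin 3) ℤ), Units.mul_inv, mul_one,
      ← mul_assoc, h1, one_mul]

lemma card_isometryGroup (G : Matrix (Fin 3) (Fin 3) ℤ) :
    Nat.card (isometryGroup G) = Nat.card {U : Matrix (Fin 3) (Fin 3) ℤ //
      IsUnit U.det ∧ Uᵀ * G * U = G} := by
  refine Nat.card_congr (Equiv.ofBijective
    (fun U => ⟨U.1.1, (isUnit_iff_isUnit_det _).1 U.1.isUnit, U.2⟩) ⟨?_, ?_⟩)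
  · intro U V h
    exact Subtype.ext (Units.ext (congrArg Subtype.val h))
  · rintro ⟨U, hU, hG⟩
    obtain ⟨V, rfl⟩ := (isUnit_iff_isUnit_det _).2 hU
    exact ⟨⟨V, hG⟩, rfl⟩

/-- In a group of order eight with a sign character and a central element of sign `-1`, the
kernel has order four and the group is commutative. -/
lemma card_ker_eq_four_and_commute {H : Type*} [Group H] (hH : Nat.card H = 8) (f : H →* ℤˣ)
    (c : H) (hc : ∀ h, c * h = h * c) (hfc : f c = -1) :
    Nat.card f.ker = 4 ∧ ∀ a b : H, a * b = b * a := by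
  have hsurj : Function.Surjective f := fun e => by
    rcases Int.units_eq_one_or e with rfl | rfl
    exacts [⟨1, map_one f⟩, ⟨c, hfc⟩]
  have hcard : Nat.card f.ker = 4 := by
    have h := f.ker.card_mul_index
    rw [Subgroup.index_ker, MonoidHom.range_eq_top.2 hsurj, Subgroup.card_top, hH,
      Nat.card_eq_fintype_card (α := ℤˣ), Fintype.card_units_int] at h
    omega
  refine ⟨hcard, ?_⟩
  have hker : ∀ a ∈ f.ker, ∀ b ∈ f.ker, a * b = b * a := fun a ha b hb => by
    have : Fact (Nat.Prime 2) := ⟨Nat.prime_two⟩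
    have := IsPGroup.isMulCommutative_of_card_eq_prime_sq (G := f.ker) (p := 2) hcard
    exact congrArg Subtype.val (mul_comm' (⟨a, ha⟩ : f.ker) ⟨b, hb⟩)
  have hright : ∀ a ∈ f.ker, ∀ b, a * b = b * a := fun a ha b => by
    rcases Int.units_eq_one_or (f b) with hb | hb
    · exact hker a ha b hb
    · have h := hker a ha (c * b) (by rw [MonoidHom.mem_ker, map_mul, hfc, hb]; rfl)
      apply mul_left_cancel (a := c)
      calc c * (a * b) = (c * a) * b := (mul_assoc _ _ _).symm
        _ = a * (c * b) := by rw [hc, mul_assoc]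
        _ = c * (b * a) := by rw [h, mul_assoc]
  intro a b
  rcases Int.units_eq_one_or (f a) with ha | ha
  · exact hright a ha b
  · have h := hright (c * a) (by rw [MonoidHom.mem_ker, map_mul, hfc, ha]; rfl) b
    apply mul_left_cancel (a := c)
    rw [← mul_assoc, h, ← mul_assoc, ← hc, mul_assoc]


/-- If `A` is a rotation of the lattice with `A ^ 4 = 1`, and all isometries commute with `A`,
then `A` is an involution. -/
lemma mul_self_eq_one_of_forall_commute {G : Matrix (Fin 3) (Fin 3) ℤ} (hsymm : G.IsSymm)
    (hpd : ∀ x : Fin 3 → ℤ, x ≠ 0 → 0 < Matrix.toBilin' G x x)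
    {A : Matrix (Fin 3) (Fin 3) ℤ} (hA : Aᵀ * G * A = G) (hAd : A.det = 1)
    (hA4 : A * A * (A * A) = 1)
    (hcomm : ∀ T : Matrix (Fin 3) (Fin 3) ℤ, IsUnit T.det → Tᵀ * G * T = G → A * T = T * A) :
    A * A = 1 := by
  by_contra hA2
  obtain ⟨z, w, u, huz, he, hwz⟩ := exists_axis_of_involution (A * A)
    (by rw [det_mul, hAd, one_mul]) hA4 hA2
  have hz : z ≠ 0 := by
    rintro rfl
    simp at huz
  have h0 : vecMulVec ((1 - A) *ᵥ z) (w ᵥ* (1 + A)) = 0 := by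
    rw [← vecMulVec_mul, ← mul_vecMulVec, ← he]
    calc (1 - A) * (1 + A * A) * (1 + A) = 1 - A * A * (A * A) := by noncomm_ring
      _ = 0 := by rw [hA4, sub_self]
  rcases vecMulVec_eq_zero.1 h0 with h | h
  · have hAz : A *ᵥ z = z := by
      rw [sub_mulVec, one_mulVec] at h
      exact (sub_eq_zero.1 h).symm
    have h1 : (1 + A * A) * (1 - A) = 0 := by
      calc (1 + A * A) * (1 - A) = (1 - A) * (1 + A * A) := by noncomm_ring
        _ = 0 := by rw [he, mul_vecMulVec, h, zero_vecMulVec]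
    obtain ⟨T, hT, hTG, hne⟩ := exists_isometry_not_commute hsymm hpd hA
      (by rintro rfl; exact hA2 (one_mul 1)) h1 hz hAz
    exact hne (hcomm T hT hTG)
  · have h1 : (1 + A * A) * (1 + A) = 0 := by
      rw [he, vecMulVec_mul, h, vecMulVec_zero]
    have hAz := eq_zero_of_mul_vecMulVec_eq_zero (X := 1 + A) hwz (by
      rw [← he, ← h1]
      noncomm_ring)
    obtain ⟨T, hT, hTG, hne⟩ := exists_isometry_not_commute hsymm hpd (A := -A)
      (by rw [transpose_neg, neg_mul, neg_mul_neg, hA])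
      (fun h => hA2 (by rw [← neg_mul_neg, h, one_mul])) (by rw [neg_mul_neg, sub_neg_eq_add, h1])
      hz (by
        rw [add_mulVec, one_mulVec] at hAz
        rw [neg_mulVec, eq_neg_of_add_eq_zero_right hAz, neg_neg])
    exact hne (by rw [neg_mul, mul_neg, hcomm T hT hTG])

/-- A positive definite ternary ℤ-lattice `M` with squarefree discriminant whose
isometry group has order 8 is isometric to a diagonal lattice `⟨a,b,c⟩`, or to
`⟨a⟩ ⊥ [[(b+c)/2,(b−c)/2],[(b−c)/2,(b+c)/2]]` (with `b ≡ c (mod 2)`), for suitable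
positive integers `a, b, c`.  (The second matrix is written `[[a,0,0],[0,s,t],[0,t,s]]`
with `s + t = b` and `s − t = c`.) -/
theorem stmt15 (G : Matrix (Fin 3) (Fin 3) ℤ) (hsymm : G.IsSymm)
    (hpd : ∀ x : Fin 3 → ℤ, x ≠ 0 → 0 < x ⬝ᵥ G.mulVec x)
    (hsf : Squarefree G.det)
    (hO : Nat.card {U : Matrix (Fin 3) (Fin 3) ℤ //
      IsUnit U.det ∧ Uᵀ * G * U = G} = 8) :
    ∃ a b c : ℤ, 0 < a ∧ 0 < b ∧ 0 < c ∧
      ((∃ U : Matrix (Fin 3) (Fin 3) ℤ, IsUnit U.det ∧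
          Uᵀ * G * U = !![a,0,0; 0,b,0; 0,0,c]) ∨
       (∃ s t : ℤ, s + t = b ∧ s - t = c ∧
          ∃ U : Matrix (Fin 3) (Fin 3) ℤ, IsUnit U.det ∧
            Uᵀ * G * U = !![a,0,0; 0,s,t; 0,t,s])) := by
  have hpd' : ∀ x : Fin 3 → ℤ, x ≠ 0 → 0 < Matrix.toBilin' G x x := fun x hx => by
    rw [Matrix.toBilin'_apply']
    exact hpd x hx
  let f : isometryGroup G →* ℤˣ := (Units.map (detMonoidHom (n := Fin 3) (R := ℤ))).comp
    (isometryGroup G).subtype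
  have hf : ∀ U : isometryGroup G, ((f U : ℤˣ) : ℤ) = det U.1.1 :=
    fun _ => rfl
  obtain ⟨hker, hcomm⟩ := card_ker_eq_four_and_commute
    (by rw [card_isometryGroup, hO]) f
    ⟨-1, show ((-1 : (Matrix (Fin 3) (Fin 3) ℤ)ˣ) : Matrix (Fin 3) (Fin 3) ℤ)ᵀ * G *
      (-1 : (Matrix (Fin 3) (Fin 3) ℤ)ˣ) = G by simp⟩
    (fun h => Subtype.ext (by simp)) (Units.ext (by
      rw [hf]
      simp [det_neg]))
  have hdet : ∀ U : isometryGroup G, U ∈ f.ker → det U.1.1 = 1 := fun U hU => by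
    rw [← hf, MonoidHom.mem_ker.1 hU, Units.val_one]
  have hinv : ∀ U : isometryGroup G, U ∈ f.ker → U.1.1 * U.1.1 = 1 := fun U hU => by
    refine mul_self_eq_one_of_forall_commute hsymm hpd' (A := U.1.1) U.2 (hdet U hU) ?_
      fun T hT hTG => ?_
    · have h : (⟨U, hU⟩ : f.ker) ^ 4 = 1 := hker ▸ pow_card_eq_one'
      have h' := congrArg
        (fun V : f.ker => V.1.1.1) h
      simpa [pow_succ, mul_assoc] using h'
    · obtain ⟨V, rfl⟩ := (isUnit_iff_isUnit_det _).2 hT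
      exact congrArg (fun W : isometryGroup G => W.1.1)
        (hcomm U ⟨V, hTG⟩)
  have : Finite f.ker := Nat.finite_of_card_ne_zero (by omega)
  let _ : Fintype f.ker := Fintype.ofFinite _
  obtain ⟨A, hA1⟩ := Fintype.exists_ne_of_one_lt_card
    (by rw [← Nat.card_eq_fintype_card]; omega) (1 : f.ker)
  obtain ⟨B, hB⟩ : ∃ B : f.ker, B ∉ ({1, A} : Set f.ker) := by
    by_contra! h
    have h1 := Set.ncard_insert_le (1 : f.ker) {A}
    rw [Set.eq_univ_of_forall h, Set.ncard_univ, hker, Set.ncard_singleton] at h1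
    omega
  rw [Set.mem_insert_iff, Set.mem_singleton_iff, not_or] at hB
  have hne : ∀ {X Y : f.ker}, X ≠ Y → X.1.1.1 ≠ Y.1.1.1 := fun hXY h =>
    hXY (Subtype.ext (Subtype.ext (Units.ext h)))
  obtain ⟨z, hz⟩ := exists_isOrthogonalFrame hsymm hpd' A.1.2 B.1.2 (hdet _ A.2) (hdet _ B.2)
    (hinv _ A.2) (hinv _ B.2) (hne hA1) (hne hB.1) (hne (Ne.symm hB.2))
    (congrArg (fun W : isometryGroup G => W.1.1) (hcomm A B))
  exact hz.classification hsf
end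

section
/- Let M be a stable ternary lattice (primitive, with squarefree odd part of discriminant) whose isometry group has order 24. Then M is isometric to [[2,1],[1,2]] ⊥ ⟨b⟩ for some positive integer b with 3b = dM, where dM is the discriminant of M. -/
open Matrix

/-- A binary form of discriminant `-3` represents `1` or `-1`. -/
theorem exists_represents_unit_of_discrim_eq_neg_three (n : ℕ) :
    ∀ α β γ : ℤ, α.natAbs ≤ n → β ^ 2 - 4 * α * γ = -3 →
      ∃ a c : ℤ, IsUnit (α * a ^ 2 + β * a * c + γ * c ^ 2) := by
  induction n with
  | zero =>
    intro α β γ hα h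
    have : α = 0 := by omega
    subst this
    nlinarith [sq_nonneg β]
  | succ n ih =>
    intro α β γ hα h
    by_cases h1 : α.natAbs ≤ 1
    · have h0 : α ≠ 0 := by
        rintro rfl
        nlinarith [sq_nonneg β]
      refine ⟨1, 0, ?_⟩
      have : α.natAbs = 1 := by omega
      simpa [Int.isUnit_iff_natAbs_eq] using this
    · have hα0 : (2 * α) ≠ 0 := by omega
      obtain ⟨k, hk⟩ : ∃ k : ℤ, |β + 2 * k * α| ≤ |α| := by
        refine ⟨-((β + |α|) / (2 * α)), ?_⟩
        have e := Int.emod_add_mul_ediv (β + |α|) (2 * α)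
        have l := Int.emod_nonneg (β + |α|) hα0
        have u := Int.emod_lt_abs (β + |α|) hα0
        have h2 : |2 * α| = 2 * |α| := by rw [abs_mul]; norm_num
        rw [h2] at u
        have : β + 2 * (-((β + |α|) / (2 * α))) * α = (β + |α|) % (2 * α) - |α| := by
          linarith
        rw [this, abs_le]
        constructor <;> linarith
      have hd : (β + 2 * k * α) ^ 2 - 4 * (α * k ^ 2 + β * k + γ) * α = -3 := by
        linear_combination h
      have hlt : |α * k ^ 2 + β * k + γ| < |α| := by
        have h2 : 2 ≤ |α| := by rw [Int.abs_eq_natAbs]; omega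
        have hsq : (β + 2 * k * α) ^ 2 ≤ |α| ^ 2 := by
          rw [← sq_abs (β + 2 * k * α)]
          exact pow_le_pow_left₀ (abs_nonneg _) hk 2
        have hm : 4 * (|α * k ^ 2 + β * k + γ| * |α|) = (β + 2 * k * α) ^ 2 + 3 := by
          rw [← abs_mul, abs_of_nonneg] <;> nlinarith [sq_nonneg (β + 2 * k * α)]
        nlinarith
      rw [Int.abs_eq_natAbs, Int.abs_eq_natAbs α] at hlt
      obtain ⟨a, c, hac⟩ := ih (α * k ^ 2 + β * k + γ) (β + 2 * k * α) α (by omega) hd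
      refine ⟨c + k * a, a, ?_⟩
      convert hac using 1
      ring

/-- Every integral vector in the plane is the image of a vector on the first axis under `SL₂(ℤ)`. -/
theorem Int.exists_rotate_to_axis (a b : ℤ) :
    ∃ x y z w g : ℤ, x * w - y * z = 1 ∧ a = x * g ∧ b = z * g := by
  by_cases h : Int.gcd a b = 0
  · obtain ⟨rfl, rfl⟩ := Int.gcd_eq_zero_iff.mp h
    exact ⟨1, 0, 0, 1, 0, by simp⟩
  · obtain ⟨x, hx⟩ := Int.gcd_dvd_left a b
    obtain ⟨z, hz⟩ := Int.gcd_dvd_right a b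
    have hb := Int.gcd_eq_gcd_ab a b
    have hg : (Int.gcd a b : ℤ) ≠ 0 := by exact_mod_cast h
    refine ⟨x, -Int.gcdB a b, z, Int.gcdA a b, Int.gcd a b, ?_, by linarith, by linarith⟩
    apply mul_left_cancel₀ hg
    linear_combination (-Int.gcdA a b) * hx - Int.gcdB a b * hz - hb

theorem exists_unimodular_mulVec_axis (v : Fin 3 → ℤ) :
    ∃ (P : Matrix (Fin 3) (Fin 3) ℤ) (d : ℤ), IsUnit P.det ∧ v = P *ᵥ ![d, 0, 0] := by
  obtain ⟨x, y, z, w, g, h, h1, h2⟩ := Int.exists_rotate_to_axis (v 1) (v 2)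
  obtain ⟨x', y', z', w', g', h', h1', h2'⟩ := Int.exists_rotate_to_axis (v 0) g
  refine ⟨!![1, 0, 0; 0, x, y; 0, z, w] * !![x', y', 0; z', w', 0; 0, 0, 1], g', ?_, ?_⟩
  · have e1 : (!![1, 0, 0; 0, x, y; 0, z, w] : Matrix (Fin 3) (Fin 3) ℤ).det = 1 := by
      simp [det_fin_three]; linarith
    have e2 : (!![x', y', 0; z', w', 0; 0, 0, 1] : Matrix (Fin 3) (Fin 3) ℤ).det = 1 := by
      simp [det_fin_three]; linarith
    rw [det_mul, e1, e2]
    simp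
  · ext i
    fin_cases i
    · simp [h1', mul_comm]
    · simp [h1, h2']; ring
    · simp [h2, h2']; ring

theorem det_sub_one_eq_zero_of_pow_three_eq_one {U : Matrix (Fin 3) (Fin 3) ℤ}
    (h3 : U ^ 3 = 1) : (U - 1).det = 0 := by
  by_contra h
  have hp : (U - 1) * (U ^ 2 + U + 1) = 0 := by
    have : (U - 1) * (U ^ 2 + U + 1) = U ^ 3 - 1 := by noncomm_ring
    rw [this, h3, sub_self]
  have hq : U ^ 2 + U + 1 = 0 := by
    have := congrArg (fun X => (U - 1).adjugate * X) hp
    simp only [← Matrix.mul_assoc, adjugate_mul, mul_zero, smul_mul, one_mul] at this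
    exact (smul_eq_zero.mp this).resolve_left h
  have hs : (2 * U + 1) * (2 * U + 1) = (-3 : ℤ) • (1 : Matrix (Fin 3) (Fin 3) ℤ) := by
    have : (2 * U + 1) * (2 * U + 1) = (4 : ℤ) • (U ^ 2 + U + 1) + (-3 : ℤ) • 1 := by
      noncomm_ring
    rw [this, hq, smul_zero, zero_add]
  have hd := congrArg det hs
  rw [det_mul, det_smul] at hd
  simp at hd
  nlinarith [mul_self_nonneg (2 * U + 1).det]

/-- An integral matrix of order three fixing the first basis vector has lower block of trace `-1`
and determinant `1`. -/
theorem lower_block_of_pow_three_eq_one {x y p q r s : ℤ}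
    (h3 : (!![1, x, y; 0, p, q; 0, r, s] : Matrix (Fin 3) (Fin 3) ℤ) ^ 3 = 1)
    (h1 : (!![1, x, y; 0, p, q; 0, r, s] : Matrix (Fin 3) (Fin 3) ℤ) ≠ 1) :
    p + s = -1 ∧ p * s - q * r = 1 := by
  have hdet : (p * s - q * r) ^ 3 = 1 := by
    have := congrArg det h3
    rw [det_pow, det_one, det_fin_three] at this
    simpa using this
  have hD : p * s - q * r = 1 := by
    have := (Odd.strictMono_pow (R := ℤ) (n := 3) (by decide)).injective
    exact this (by simpa using hdet)
  refine ⟨?_, hD⟩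
  rw [pow_succ, pow_two] at h3
  have e := fun i j => congrFun (congrFun h3 i) j
  have e01 := e 0 1
  have e02 := e 0 2
  have e11 := e 1 1
  have e12 := e 1 2
  have e21 := e 2 1
  have e22 := e 2 2
  simp [Matrix.mul_apply, Fin.sum_univ_three] at e01 e02 e11 e12 e21 e22
  have k12 : q * ((p + s) ^ 2 - 1) = 0 := by linear_combination e12 + q * hD
  have k21 : r * ((p + s) ^ 2 - 1) = 0 := by linear_combination e21 + r * hD
  have k11 : p * ((p + s) ^ 2 - 1) = p + s + 1 := by
    linear_combination e11 + (2 * p + s) * hD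
  have k22 : s * ((p + s) ^ 2 - 1) = p + s + 1 := by
    linear_combination e22 + (2 * s + p) * hD
  by_cases ht : (p + s) ^ 2 - 1 = 0
  · rw [ht, mul_zero] at k11
    linarith
  · exfalso
    have hq := (mul_eq_zero.mp k12).resolve_right ht
    have hr := (mul_eq_zero.mp k21).resolve_right ht
    have hps : p = s := mul_right_cancel₀ ht (k11.trans k22.symm)
    subst hq hr hps
    have hp : p = 1 := by
      have := (Odd.strictMono_pow (R := ℤ) (n := 3) (by decide)).injective
      exact this (by simp only; linarith)
    subst hp
    have hx : x = 0 := by linarith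
    have hy : y = 0 := by linarith
    subst hx hy
    apply h1
    ext i j
    fin_cases i <;> fin_cases j <;> rfl

/-- Conjugacy classes of integral matrices of order three. -/
theorem exists_conj_of_pow_three_eq_one {U : Matrix (Fin 3) (Fin 3) ℤ}
    (h3 : U ^ 3 = 1) (h1 : U ≠ 1) :
    ∃ P : Matrix (Fin 3) (Fin 3) ℤ, IsUnit P.det ∧
      (U * P = P * !![0, -1, 0; 1, -1, 0; 0, 0, 1] ∨
        U * P = P * !![0, 0, 1; 1, 0, 0; 0, 1, 0]) := by
  obtain ⟨v, hv0, hv⟩ := exists_mulVec_eq_zero_iff.mpr (det_sub_one_eq_zero_of_pow_three_eq_one h3)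
  obtain ⟨P, d, hP, rfl⟩ := exists_unimodular_mulVec_axis v
  have hd : d ≠ 0 := by
    rintro rfl
    apply hv0
    ext i
    fin_cases i <;> simp [mulVec, dotProduct, Fin.sum_univ_three]
  set W := P⁻¹ * U * P with hW
  have hPW : U * P = P * W := by
    rw [hW, Matrix.mul_assoc, mul_nonsing_inv_cancel_left _ _ hP]
  have hW3 : W ^ 3 = 1 := by
    have : P * W ^ 3 = U ^ 3 * P := by
      simp only [pow_succ, pow_zero, one_mul, ← Matrix.mul_assoc, ← hPW]
      simp only [Matrix.mul_assoc, ← hPW]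
    rw [h3, one_mul] at this
    calc W ^ 3 = P⁻¹ * (P * W ^ 3) := (nonsing_inv_mul_cancel_left _ _ hP).symm
      _ = 1 := by rw [this, nonsing_inv_mul _ hP]
  have hW1 : W ≠ 1 := by
    intro h
    apply h1
    rw [h, mul_one] at hPW
    calc U = U * P * P⁻¹ := (mul_nonsing_inv_cancel_right _ _ hP).symm
      _ = 1 := by rw [hPW, mul_nonsing_inv _ hP]
  have hWe : W *ᵥ ![d, 0, 0] = ![d, 0, 0] := by
    rw [sub_mulVec, one_mulVec, sub_eq_zero, mulVec_mulVec, hPW] at hv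
    have := congrArg (fun x => P⁻¹ *ᵥ x) hv
    simpa only [mulVec_mulVec, ← Matrix.mul_assoc, nonsing_inv_mul _ hP, one_mul, one_mulVec]
      using this
  obtain ⟨x, y, p, q, r, s, hWs⟩ : ∃ x y p q r s : ℤ, W = !![1, x, y; 0, p, q; 0, r, s] := by
    refine ⟨W 0 1, W 0 2, W 1 1, W 1 2, W 2 1, W 2 2, ?_⟩
    have c0 := congrFun hWe 0
    have c1 := congrFun hWe 1
    have c2 := congrFun hWe 2
    simp [mulVec, dotProduct, Fin.sum_univ_three, hd] at c0 c1 c2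
    ext i j
    fin_cases i <;> fin_cases j <;> simp [c0, c1, c2]
  rw [hWs] at hW3 hW1 hPW
  obtain ⟨ht, hD⟩ := lower_block_of_pow_three_eq_one hW3 hW1
  obtain ⟨a, c, hac⟩ := exists_represents_unit_of_discrim_eq_neg_three _ r (s - p) (-q) le_rfl
    (by linear_combination (p + s - 1) * ht - 4 * hD)
  obtain rfl : s = -1 - p := by linarith
  suffices h : ∃ Q : Matrix (Fin 3) (Fin 3) ℤ, IsUnit Q.det ∧
      (!![1, x, y; 0, p, q; 0, r, -1 - p] * Q = Q * !![0, -1, 0; 1, -1, 0; 0, 0, 1] ∨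
        !![1, x, y; 0, p, q; 0, r, -1 - p] * Q = Q * !![0, 0, 1; 1, 0, 0; 0, 1, 0]) by
    obtain ⟨Q, hQ, h⟩ := h
    refine ⟨P * Q, by rw [det_mul]; exact hP.mul hQ, ?_⟩
    rw [← Matrix.mul_assoc, hPW, Matrix.mul_assoc, Matrix.mul_assoc, Matrix.mul_assoc]
    exact h.imp (fun h => by rw [h]) (fun h => by rw [h])
  -- `X`, `A` and `C` describe the image of `(m, a, c)`
  obtain ⟨X, hX⟩ : ∃ X, X = x * a + y * c := ⟨_, rfl⟩
  obtain ⟨A, hA⟩ : ∃ A, A = p * a + q * c := ⟨_, rfl⟩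
  obtain ⟨C, hC⟩ : ∃ C, C = r * a + (-1 - p) * c := ⟨_, rfl⟩
  obtain ⟨m, ε, hkm, hε⟩ : ∃ m ε : ℤ, 2 * X + x * A + y * C + 3 * m = ε ∧
      (ε = 0 ∨ IsUnit ε) := by
    generalize 2 * X + x * A + y * C = k
    have : k % 3 = 0 ∨ k % 3 = 1 ∨ k % 3 = 2 := by omega
    rcases this with h | h | h
    · exact ⟨-(k / 3), 0, by omega, Or.inl rfl⟩
    · exact ⟨-(k / 3), 1, by omega, Or.inr isUnit_one⟩
    · exact ⟨-(k / 3) - 1, -1, by omega, Or.inr isUnit_one.neg⟩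
  have hAC : a * C - c * A = r * a ^ 2 + (-1 - p - p) * a * c + -q * c ^ 2 := by
    rw [hA, hC]; ring
  rw [← hAC] at hac
  rcases hε with rfl | hε
  · refine ⟨!![m, m + X, 1; a, A, 0; c, C, 0], ?_, Or.inl ?_⟩
    · convert hac using 1
      simp [det_fin_three]
      ring
    · ext i j
      fin_cases i <;> fin_cases j <;> simp [Matrix.mul_apply, Fin.sum_univ_three]
      · linarith
      · linarith
      · linarith
      · rw [hA, hC]; linear_combination (-a) * hD
      · linarith
      · rw [hA, hC]; linear_combination (-c) * hD
  · refine ⟨!![m, m + X, m + X + x * A + y * C; a, A, -a - A; c, C, -c - C], ?_, Or.inr ?_⟩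
    · convert hε.mul hac using 1
      rw [← hkm]
      simp [det_fin_three]
      ring
    · ext i j
      fin_cases i <;> fin_cases j <;> simp [Matrix.mul_apply, Fin.sum_univ_three]
      · linarith
      · linarith
      · linarith
      · rw [hA, hC]; linear_combination (-a) * hD
      · rw [hA, hC]; linear_combination a * hD
      · linarith
      · rw [hA, hC]; linear_combination (-c) * hD
      · rw [hA, hC]; linear_combination c * hD

/-- The isometry group of the lattice with Gram matrix `G`. -/
def gramIsometryGroup {n : Type*} [Fintype n] [DecidableEq n] (G : Matrix n n ℤ) :
    Subgroup (Matrix n n ℤ)ˣ where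
  carrier := {u | (u : Matrix n n ℤ)ᵀ * G * u = G}
  one_mem' := by simp
  mul_mem' := by
    intro u v hu hv
    have : (u * v : Matrix n n ℤ)ᵀ * G * (u * v : Matrix n n ℤ)
        = (v : Matrix n n ℤ)ᵀ * ((u : Matrix n n ℤ)ᵀ * G * u) * v := by
      simp only [transpose_mul, Matrix.mul_assoc]
    change (u * v : Matrix n n ℤ)ᵀ * G * (u * v : Matrix n n ℤ) = G
    rw [this, show (u : Matrix n n ℤ)ᵀ * G * u = G from hu]
    exact hv
  inv_mem' := by
    intro u hu
    have hu : (u : Matrix n n ℤ)ᵀ * G * u = G := hu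
    have h : ((u⁻¹ : (Matrix n n ℤ)ˣ) : Matrix n n ℤ)ᵀ * (u : Matrix n n ℤ)ᵀ = 1 := by
      rw [← transpose_mul, Units.mul_inv, transpose_one]
    change ((u⁻¹ : (Matrix n n ℤ)ˣ) : Matrix n n ℤ)ᵀ * G *
      ((u⁻¹ : (Matrix n n ℤ)ˣ) : Matrix n n ℤ) = G
    conv_lhs => rw [← hu]
    simp only [← Matrix.mul_assoc, h, Matrix.one_mul]
    rw [Matrix.mul_assoc, Units.mul_inv, Matrix.mul_one]

theorem mem_gramIsometryGroup {n : Type*} [Fintype n] [DecidableEq n] {G : Matrix n n ℤ}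
    {u : (Matrix n n ℤ)ˣ} :
    u ∈ gramIsometryGroup G ↔ (u : Matrix n n ℤ)ᵀ * G * u = G := Iff.rfl

theorem card_gramIsometryGroup {n : Type*} [Fintype n] [DecidableEq n] (G : Matrix n n ℤ) :
    Nat.card (gramIsometryGroup G) =
      Nat.card {U : Matrix n n ℤ // IsUnit U.det ∧ Uᵀ * G * U = G} := by
  refine Nat.card_congr
    (Equiv.ofBijective (fun u => ⟨(u : (Matrix n n ℤ)ˣ), ?_, u.2⟩) ⟨?_, ?_⟩)
  · exact (isUnit_iff_isUnit_det _).mp u.1.isUnit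
  · intro u v h
    exact Subtype.ext (Units.ext (congrArg Subtype.val h))
  · rintro ⟨U, hU, hG⟩
    obtain ⟨u, rfl⟩ := (isUnit_iff_isUnit_det _).mpr hU
    exact ⟨⟨u, hG⟩, rfl⟩

/-- Isometric lattices have equinumerous isometry groups. -/
theorem card_gramIsometryGroup_congr {n : Type*} [Fintype n] [DecidableEq n] (G : Matrix n n ℤ)
    (p : (Matrix n n ℤ)ˣ) :
    Nat.card (gramIsometryGroup ((p : Matrix n n ℤ)ᵀ * G * (p : Matrix n n ℤ))) =
      Nat.card (gramIsometryGroup G) := by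
  refine Nat.card_congr ((MulAut.conj p).toEquiv.subtypeEquiv fun u => ?_)
  have hp : ((p⁻¹ : (Matrix n n ℤ)ˣ) : Matrix n n ℤ)ᵀ * (p : Matrix n n ℤ)ᵀ = 1 := by
    rw [← transpose_mul, Units.mul_inv, transpose_one]
  have hp' : (p : Matrix n n ℤ)ᵀ * ((p⁻¹ : (Matrix n n ℤ)ˣ) : Matrix n n ℤ)ᵀ = 1 := by
    rw [← transpose_mul, Units.inv_mul, transpose_one]
  simp only [mem_gramIsometryGroup, MulEquiv.toEquiv_eq_coe, EquivLike.coe_coe,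
    MulAut.conj_apply, Units.val_mul, transpose_mul]
  constructor
  · intro h
    have := congrArg (fun X => ((p⁻¹ : (Matrix n n ℤ)ˣ) : Matrix n n ℤ)ᵀ * X *
      ((p⁻¹ : (Matrix n n ℤ)ˣ) : Matrix n n ℤ)) h
    simp only [← Matrix.mul_assoc, hp, Matrix.one_mul] at this
    simpa only [Matrix.mul_assoc, Units.mul_inv, Matrix.mul_one] using this
  · intro h
    have := congrArg (fun X => (p : Matrix n n ℤ)ᵀ * X * (p : Matrix n n ℤ)) h
    simp only [← Matrix.mul_assoc, hp', Matrix.one_mul] at this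
    simpa only [Matrix.mul_assoc, Units.inv_mul, Matrix.mul_one] using this

/-- Gram matrices `1 + t J` with `J` the all-ones matrix. -/
def onesShift (t : ℤ) : Matrix (Fin 3) (Fin 3) ℤ := !![t + 1, t, t; t, t + 1, t; t, t, t + 1]

/-- Signed permutation matrices are isometries of `ℤ³`. -/
theorem le_card_gramIsometryGroup_onesShift_zero [Finite (gramIsometryGroup (onesShift 0))] :
    48 ≤ Nat.card (gramIsometryGroup (onesShift 0)) := by
  let M : Equiv.Perm (Fin 3) × (Fin 3 → ℤˣ) → Matrix (Fin 3) (Fin 3) ℤ :=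
    fun x => of fun i j => if x.1 j = i then (x.2 j : ℤ) else 0
  have hM : ∀ x, (M x)ᵀ * M x = 1 := by decide
  have hinj : Function.Injective M := by
    rintro ⟨σ, ε⟩ ⟨τ, δ⟩ h
    have h' : ∀ j, (ε j : ℤ) = if τ j = σ j then (δ j : ℤ) else 0 := fun j => by
      simpa [M] using congrFun (congrFun h (σ j)) j
    have hστ : ∀ j, τ j = σ j := fun j => by
      by_contra hne
      have := h' j
      rw [if_neg hne] at this
      exact (ε j).ne_zero this
    ext j
    · simp [hστ j]
    · simpa [hστ j] using h' j
  let f : Equiv.Perm (Fin 3) × (Fin 3 → ℤˣ) → gramIsometryGroup (onesShift 0) := fun x =>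
    ⟨⟨M x, (M x)ᵀ, mul_eq_one_comm.mp (hM x), hM x⟩, by
      have : onesShift 0 = 1 := by
        ext i j; fin_cases i <;> fin_cases j <;> rfl
      rw [mem_gramIsometryGroup, this, mul_one]
      exact hM x⟩
  have hf : Function.Injective f := fun x y h =>
    hinj (congrArg (fun u : gramIsometryGroup (onesShift 0) =>
      ((u : (Matrix (Fin 3) (Fin 3) ℤ)ˣ) : Matrix (Fin 3) (Fin 3) ℤ)) h)
  have := Nat.card_le_card_of_injective f hf
  have hc : Nat.card (Equiv.Perm (Fin 3) × (Fin 3 → ℤˣ)) = 48 := by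
    simp [Fintype.card_perm, Nat.factorial]
  omega

theorem Int.column_sum_le {t x y z : ℤ} (ht : 2 ≤ t)
    (h : x ^ 2 + y ^ 2 + z ^ 2 + t * (x + y + z) ^ 2 = t + 1) :
    x + y + z = -1 ∨ x + y + z = 0 ∨ x + y + z = 1 := by
  have h1 : (x + y + z) ^ 2 ≤ 3 * (x ^ 2 + y ^ 2 + z ^ 2) := by
    nlinarith [sq_nonneg (x - y), sq_nonneg (y - z), sq_nonneg (x - z)]
  have h2 : (x + y + z) ^ 2 < 2 ^ 2 := by nlinarith
  have := abs_lt.mp (abs_lt_of_sq_lt_sq h2 (by norm_num))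
  omega

theorem Int.column_sums_eq {t x y z x' y' z' : ℤ} (ht : 2 ≤ t)
    (h : x ^ 2 + y ^ 2 + z ^ 2 + t * (x + y + z) ^ 2 = t + 1)
    (h' : x' ^ 2 + y' ^ 2 + z' ^ 2 + t * (x' + y' + z') ^ 2 = t + 1)
    (hh : x * x' + y * y' + z * z' + t * ((x + y + z) * (x' + y' + z')) = t) :
    x + y + z = x' + y' + z' := by
  by_contra hne
  have h1 : (x - x') ^ 2 + (y - y') ^ 2 + (z - z') ^ 2 +
      t * ((x + y + z) - (x' + y' + z')) ^ 2 = 2 := by linear_combination h + h' - 2 * hh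
  have h2 : 1 ≤ ((x + y + z) - (x' + y' + z')) ^ 2 := by
    have := sq_pos_of_ne_zero (sub_ne_zero.mpr hne)
    omega
  have h3 : (x - x') ^ 2 + (y - y') ^ 2 + (z - z') ^ 2 ≤ 0 := by nlinarith
  have hx : x - x' = 0 := by
    apply pow_eq_zero_iff two_ne_zero |>.mp
    nlinarith [sq_nonneg (x - x'), sq_nonneg (y - y'), sq_nonneg (z - z')]
  have hy : y - y' = 0 := by
    apply pow_eq_zero_iff two_ne_zero |>.mp
    nlinarith [sq_nonneg (x - x'), sq_nonneg (y - y'), sq_nonneg (z - z')]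
  have hz : z - z' = 0 := by
    apply pow_eq_zero_iff two_ne_zero |>.mp
    nlinarith [sq_nonneg (x - x'), sq_nonneg (y - y'), sq_nonneg (z - z')]
  omega

theorem Int.exists_eq_single_of_sum_sq {x : Fin 3 → ℤ}
    (h : x 0 ^ 2 + x 1 ^ 2 + x 2 ^ 2 = 1) {s : ℤˣ} (hs : x 0 + x 1 + x 2 = s) :
    ∃ i, x = Pi.single i (s : ℤ) := by
  have b : ∀ i, x i = 0 ∨ x i = 1 ∨ x i = -1 := fun i => by
    have : x i ^ 2 < 2 ^ 2 := by
      fin_cases i <;> simp <;> nlinarith [sq_nonneg (x 0), sq_nonneg (x 1), sq_nonneg (x 2)]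
    have := abs_lt.mp (abs_lt_of_sq_lt_sq this (by norm_num))
    omega
  have hx : x = ![x 0, x 1, x 2] := by
    ext i; fin_cases i <;> rfl
  rcases b 0 with h0 | h0 | h0 <;> rcases b 1 with h1 | h1 | h1 <;>
    rcases b 2 with h2 | h2 | h2 <;> rw [h0, h1, h2] at h hs hx <;> norm_num at h
  all_goals
    rw [hx, ← hs]
    first
    | exact ⟨0, by decide⟩
    | exact ⟨1, by decide⟩
    | exact ⟨2, by decide⟩

/-- For `t ≥ 2` the only isometries are the permutation matrices up to sign. -/
theorem card_gramIsometryGroup_onesShift_le {t : ℤ} (ht : 2 ≤ t) :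
    Nat.card (gramIsometryGroup (onesShift t)) ≤ 12 := by
  let f : Equiv.Perm (Fin 3) × ℤˣ → Matrix (Fin 3) (Fin 3) ℤ :=
    fun x => of fun i j => (Pi.single (x.1 j) (x.2 : ℤ) : Fin 3 → ℤ) i
  have key : ∀ u : gramIsometryGroup (onesShift t),
      ∃ x, f x = ((u : (Matrix (Fin 3) (Fin 3) ℤ)ˣ) : Matrix (Fin 3) (Fin 3) ℤ) := by
    rintro ⟨u, hu⟩
    rw [mem_gramIsometryGroup] at hu
    have hdet : IsUnit (u : Matrix (Fin 3) (Fin 3) ℤ).det :=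
      (isUnit_iff_isUnit_det _).mp u.isUnit
    generalize (u : Matrix (Fin 3) (Fin 3) ℤ) = V at hu hdet
    change ∃ x, f x = V
    have e : ∀ i j, V 0 i * V 0 j + V 1 i * V 1 j + V 2 i * V 2 j +
        t * ((V 0 i + V 1 i + V 2 i) * (V 0 j + V 1 j + V 2 j)) = onesShift t i j := fun i j => by
      rw [← congrFun (congrFun hu i) j]
      simp [Matrix.mul_apply, Fin.sum_univ_three, onesShift]
      ring
    have ed : ∀ j, V 0 j ^ 2 + V 1 j ^ 2 + V 2 j ^ 2 + t * (V 0 j + V 1 j + V 2 j) ^ 2 = t + 1 :=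
      fun j => by
        have : onesShift t j j = t + 1 := by fin_cases j <;> rfl
        rw [← this, ← e j j]; ring
    have hoff : ∀ i j, i ≠ j → onesShift t i j = t := by
      intro i j hij
      fin_cases i <;> fin_cases j <;> first | exact absurd rfl hij | rfl
    have hs : ∀ i j, V 0 i + V 1 i + V 2 i = V 0 j + V 1 j + V 2 j := fun i j => by
      by_cases hij : i = j
      · rw [hij]
      · exact Int.column_sums_eq ht (ed i) (ed j) ((e i j).trans (hoff i j hij))
    obtain ⟨s, hs0⟩ : ∃ s : ℤˣ, V 0 0 + V 1 0 + V 2 0 = s := by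
      rcases Int.column_sum_le ht (ed 0) with h | h | h
      · exact ⟨-1, by simpa using h⟩
      · exfalso
        have : V.det = 0 := by
          have h1 := (hs 1 0).trans h
          have h2 := (hs 2 0).trans h
          rw [det_fin_three]
          have a0 : V 0 0 = -V 1 0 - V 2 0 := by linarith
          have a1 : V 0 1 = -V 1 1 - V 2 1 := by linarith
          have a2 : V 0 2 = -V 1 2 - V 2 2 := by linarith
          rw [a0, a1, a2]; ring
        rw [this] at hdet
        exact not_isUnit_zero hdet
      · exact ⟨1, by simpa using h⟩
    have hsj : ∀ j, V 0 j + V 1 j + V 2 j = s := fun j => (hs j 0).trans hs0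
    have hss : (s : ℤ) * s = 1 := by
      rw [← Units.val_mul, Int.units_mul_self, Units.val_one]
    have hcol : ∀ j, ∃ i, (fun k => V k j) = Pi.single i (s : ℤ) := fun j =>
      Int.exists_eq_single_of_sum_sq (x := fun k => V k j)
        (by have := ed j; rw [hsj j] at this; linear_combination this - t * hss) (hsj j)
    choose σ hσ using hcol
    have hσinj : Function.Injective σ := by
      intro i j hij
      by_contra hne
      have h0 := (e i j).trans (hoff i j hne)
      have hk : ∀ k, V k i = V k j := fun k => by
        have := (hσ i).trans ((congrArg (fun l => Pi.single l (s : ℤ)) hij).trans (hσ j).symm)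
        exact congrFun this k
      rw [hk 0, hk 1, hk 2] at h0
      have := ed j
      linarith
    refine ⟨(Equiv.ofBijective σ (Finite.injective_iff_bijective.mp hσinj), s), ?_⟩
    ext i j
    exact (congrFun (hσ j) i).symm
  choose g hg using key
  have hginj : Function.Injective g := fun u v h =>
    Subtype.ext (Units.ext (by rw [← hg u, ← hg v, h]))
  have := Nat.card_le_card_of_injective g hginj
  have hc : Nat.card (Equiv.Perm (Fin 3) × ℤˣ) = 12 := by
    simp [Fintype.card_perm, Nat.factorial]
  omega

theorem exists_mem_gramIsometryGroup_pow_three {n : Type*} [Fintype n] [DecidableEq n]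
    {G : Matrix n n ℤ} [Finite (gramIsometryGroup G)] (h : 3 ∣ Nat.card (gramIsometryGroup G)) :
    ∃ U : Matrix n n ℤ, Uᵀ * G * U = G ∧ U ^ 3 = 1 ∧ U ≠ 1 := by
  have : Fact (Nat.Prime 3) := ⟨Nat.prime_three⟩
  obtain ⟨u, hu⟩ := exists_prime_orderOf_dvd_card' 3 h
  refine ⟨(u : (Matrix n n ℤ)ˣ), u.2, ?_, fun h1 => ?_⟩
  · have := pow_orderOf_eq_one u
    rw [hu] at this
    simpa using congrArg (fun u : gramIsometryGroup G => ((u : (Matrix n n ℤ)ˣ) : Matrix n n ℤ))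
      this
  · have : u = 1 := Subtype.ext (Units.ext h1)
    rw [this, orderOf_one] at hu
    norm_num at hu

theorem det_transpose_mul_mul_self {n : Type*} [Fintype n] [DecidableEq n] {G P : Matrix n n ℤ}
    (hP : IsUnit P.det) : (Pᵀ * G * P).det = G.det := by
  rw [det_mul, det_mul, det_transpose, mul_right_comm, Int.isUnit_mul_self hP, one_mul]

/-- Transporting an isometry along a change of basis. -/
theorem transpose_mul_mul_of_conj {n : Type*} [Fintype n] {G U P S : Matrix n n ℤ}
    (hU : Uᵀ * G * U = G) (h : U * P = P * S) : Sᵀ * (Pᵀ * G * P) * S = Pᵀ * G * P := by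
  calc Sᵀ * (Pᵀ * G * P) * S = (P * S)ᵀ * G * (P * S) := by
        simp only [transpose_mul, Matrix.mul_assoc]
    _ = Pᵀ * (Uᵀ * G * U) * P := by
        rw [← h]; simp only [transpose_mul, Matrix.mul_assoc]
    _ = Pᵀ * G * P := by rw [hU]

theorem dotProduct_congruence_pos {n : Type*} [Fintype n] [DecidableEq n] {G P : Matrix n n ℤ}
    (hG : ∀ x : n → ℤ, x ≠ 0 → 0 < x ⬝ᵥ G *ᵥ x) (hP : IsUnit P.det) (x : n → ℤ) (hx : x ≠ 0) :
    0 < x ⬝ᵥ (Pᵀ * G * P) *ᵥ x := by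
  have h : P *ᵥ x ≠ 0 := fun h => hx <| by
    have := congrArg (P⁻¹ *ᵥ ·) h
    simpa [mulVec_mulVec, nonsing_inv_mul _ hP] using this
  rw [← mulVec_mulVec, ← mulVec_mulVec, dotProduct_mulVec, vecMul_transpose]
  exact hG _ h

theorem eq_of_squarefree_of_rotation {G : Matrix (Fin 3) (Fin 3) ℤ} (hsymm : G.IsSymm)
    (hpd : ∀ x : Fin 3 → ℤ, x ≠ 0 → 0 < x ⬝ᵥ G *ᵥ x) (hsf : Squarefree G.det)
    (hS : !![0, -1, 0; 1, -1, 0; 0, 0, 1]ᵀ * G * !![0, -1, 0; 1, -1, 0; 0, 0, 1] = G) :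
    ∃ b : ℤ, 0 < b ∧ G = !![2, -1, 0; -1, 2, 0; 0, 0, b] := by
  have e := fun i j => congrFun (congrFun hS i) j
  have e00 := e 0 0
  have e01 := e 0 1
  have e02 := e 0 2
  have e12 := e 1 2
  simp [Matrix.mul_apply, Fin.sum_univ_three] at e00 e01 e02 e12
  have s10 := hsymm.apply 0 1
  have s20 := hsymm.apply 0 2
  have s21 := hsymm.apply 1 2
  have a02 : G 0 2 = 0 := by linarith
  have a12 : G 1 2 = 0 := by linarith
  have a00 : G 0 0 = -2 * G 0 1 := by linarith
  have hdet : G.det = G 0 1 * G 0 1 * (3 * G 2 2) := by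
    rw [det_fin_three, s10, s20, s21, a02, a12, e00, a00]; ring
  have p0 := hpd ![1, 0, 0] (fun h => by simpa using congrFun h 0)
  have p2 := hpd ![0, 0, 1] (fun h => by simpa using congrFun h 2)
  simp [dotProduct, mulVec, Fin.sum_univ_three] at p0 p2
  have hu := Int.isUnit_iff.mp (hsf _ (hdet ▸ dvd_mul_right _ _))
  have a01 : G 0 1 = -1 := by omega
  refine ⟨G 2 2, p2, ?_⟩
  ext i j
  fin_cases i <;> fin_cases j <;> simp <;> omega

theorem eq_onesShift_of_squarefree_of_cyclic {G : Matrix (Fin 3) (Fin 3) ℤ} (hsymm : G.IsSymm)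
    (hpd : ∀ x : Fin 3 → ℤ, x ≠ 0 → 0 < x ⬝ᵥ G *ᵥ x) (hsf : Squarefree G.det)
    (hS : !![0, 0, 1; 1, 0, 0; 0, 1, 0]ᵀ * G * !![0, 0, 1; 1, 0, 0; 0, 1, 0] = G) :
    ∃ t : ℤ, (t = 0 ∨ 2 ≤ t) ∧ G = onesShift t := by
  have e := fun i j => congrFun (congrFun hS i) j
  have e00 := e 0 0
  have e11 := e 1 1
  have e01 := e 0 1
  have e12 := e 1 2
  simp [Matrix.mul_apply, Fin.sum_univ_three] at e00 e11 e01 e12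
  have s10 := hsymm.apply 0 1
  have s20 := hsymm.apply 0 2
  have s21 := hsymm.apply 1 2
  have a02 : G 0 2 = G 0 1 := by linarith
  have a12 : G 1 2 = G 0 1 := by linarith
  have hdet : G.det = (G 0 0 - G 0 1) * (G 0 0 - G 0 1) * (G 0 0 + 2 * G 0 1) := by
    rw [det_fin_three, s10, s20, s21, a02, a12, e11, e00]; ring
  have p0 := hpd ![1, -1, 0] (fun h => by simpa using congrFun h 0)
  have p2 := hpd ![1, 1, 1] (fun h => by simpa using congrFun h 2)
  simp [dotProduct, mulVec, Fin.sum_univ_three] at p0 p2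
  have hu := Int.isUnit_iff.mp (hsf _ (hdet ▸ dvd_mul_right _ _))
  have a00 : G 0 0 = G 0 1 + 1 := by omega
  have h1 : G 0 1 ≠ 1 := fun h => by
    have : IsUnit (2 : ℤ) := hsf 2 (by rw [hdet, a00, h]; norm_num)
    norm_num [Int.isUnit_iff] at this
  refine ⟨G 0 1, by omega, ?_⟩
  ext i j
  fin_cases i <;> fin_cases j <;> simp [onesShift] <;> omega

/-- A stable (primitive, squarefree discriminant) positive definite ternary ℤ-lattice
whose isometry group has order 24 is isometric to `[[2,1],[1,2]] ⊥ ⟨b⟩` with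
`3b = dM`. -/
theorem stmt17 (G : Matrix (Fin 3) (Fin 3) ℤ) (hsymm : G.IsSymm)
    (hpd : ∀ x : Fin 3 → ℤ, x ≠ 0 → 0 < x ⬝ᵥ G.mulVec x)
    (hprim : ∀ d : ℤ, (∀ i j, d ∣ G i j) → IsUnit d)
    (hsf : Squarefree G.det)
    (hO : Nat.card {U : Matrix (Fin 3) (Fin 3) ℤ //
      IsUnit U.det ∧ Uᵀ * G * U = G} = 24) :
    ∃ b : ℤ, 0 < b ∧ 3 * b = G.det ∧
      ∃ U : Matrix (Fin 3) (Fin 3) ℤ, IsUnit U.det ∧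
        Uᵀ * G * U = !![2,1,0; 1,2,0; 0,0,b] := by
  rw [← card_gramIsometryGroup] at hO
  have hfin : Finite (gramIsometryGroup G) := Nat.finite_of_card_ne_zero (by omega)
  obtain ⟨U, hU, h3, h1⟩ := exists_mem_gramIsometryGroup_pow_three (G := G) (by rw [hO]; norm_num)
  obtain ⟨P, hP, h⟩ := exists_conj_of_pow_three_eq_one h3 h1
  have hsymm' : (Pᵀ * G * P).IsSymm := by
    rw [IsSymm, transpose_mul, transpose_mul, transpose_transpose, hsymm.eq, Matrix.mul_assoc]
  have hpd' := dotProduct_congruence_pos hpd hP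
  have hdet := det_transpose_mul_mul_self (G := G) hP
  rw [← hdet] at hsf
  rcases h with h | h
  · obtain ⟨b, hb, hG⟩ :=
      eq_of_squarefree_of_rotation hsymm' hpd' hsf (transpose_mul_mul_of_conj hU h)
    refine ⟨b, hb, ?_, P * diagonal ![1, -1, 1], ?_, ?_⟩
    · rw [← hdet, hG]
      simp [det_fin_three]
      ring
    · rw [det_mul, det_diagonal]
      exact hP.mul (by simp [Fin.prod_univ_three])
    · have : (P * diagonal ![1, -1, 1])ᵀ * G * (P * diagonal ![1, -1, 1]) =
          (diagonal ![1, -1, 1])ᵀ * (Pᵀ * G * P) * diagonal ![1, -1, 1] := by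
        simp only [transpose_mul, Matrix.mul_assoc]
      rw [this, hG, diagonal_transpose]
      ext i j
      fin_cases i <;> fin_cases j <;> simp
  · exfalso
    obtain ⟨t, ht, hG⟩ :=
      eq_onesShift_of_squarefree_of_cyclic hsymm' hpd' hsf (transpose_mul_mul_of_conj hU h)
    obtain ⟨p, rfl⟩ := (isUnit_iff_isUnit_det _).mpr hP
    have hc := card_gramIsometryGroup_congr G p
    rw [hG, hO] at hc
    rcases ht with rfl | ht
    · have : Finite (gramIsometryGroup (onesShift 0)) := Nat.finite_of_card_ne_zero (by omega)
      have := le_card_gramIsometryGroup_onesShift_zero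
      omega
    · have := card_gramIsometryGroup_onesShift_le ht
      omega
end
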